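/- arXiv:1406.6509 — 3 statements merged into one kernel-verified Lean document; each statement's English description precedes it below -/
import Mathlib

section
/- (i) For every μ with 0 < μ < μ₁(p), problem (AP) has no nontrivial solution. (ii) Problem (AP) admits a solution v with v(r) > 0 for all r ∈ (0,1) if and only if μ = μ₁(p). -/
open Set Filter Topology intervalIntegral

/-- `v` (with derivative `v'`) is a solution of problem (AP) with exponent `p`,
weight `a` and parameter `μ`: `v ∈ C¹[0,1]`, `r ↦ |v'|^{p-2} v'` is differentiable on `(0,1)`
with derivative `-(μ^{p-1}(p-1) r^{p-2} a(r) |v|^{p-2} v)`, and `v'(0) = v(1) = 0`. -/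
def APSol (p μ : ℝ) (a v v' : ℝ → ℝ) : Prop :=
  ContinuousOn v' (Icc 0 1) ∧
  (∀ r ∈ Icc (0:ℝ) 1, HasDerivWithinAt v (v' r) (Icc 0 1) r) ∧
  (∀ r ∈ Ioo (0:ℝ) 1,
    HasDerivAt (fun t => |v' t| ^ (p - 2) * v' t)
      (-(μ ^ (p - 1) * (p - 1) * r ^ (p - 2) * a r * (|v r| ^ (p - 2) * v r))) r) ∧
  v' 0 = 0 ∧ v 1 = 0

/-- The Rayleigh-quotient infimum `η₁(p)`. -/
noncomputable def eta1 (a : ℝ → ℝ) (p : ℝ) : ℝ :=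
  sInf { q : ℝ | ∃ v v' : ℝ → ℝ,
    ContinuousOn v' (Icc 0 1) ∧
    (∀ r ∈ Icc (0:ℝ) 1, HasDerivWithinAt v (v' r) (Icc 0 1) r) ∧
    v' 0 = 0 ∧ v 1 = 0 ∧ (∃ r ∈ Icc (0:ℝ) 1, v r ≠ 0) ∧
    q = (∫ r in (0:ℝ)..1, |v' r| ^ p) /
        ((p - 1) * ∫ r in (0:ℝ)..1, r ^ (p - 2) * a r * |v r| ^ p) }

/-- The principal eigenvalue `μ₁(p) = η₁(p)^{1/(p-1)}`. -/
noncomputable def mu1 (a : ℝ → ℝ) (p : ℝ) : ℝ := eta1 a p ^ (1 / (p - 1))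


lemma young_aux (p : ℝ) (hp : 2 ≤ p) (x y : ℝ) (hx : 0 ≤ x) (hy : 0 ≤ y) :
    p * (x ^ (p - 1) * y) ≤ (p - 1) * x ^ p + y ^ p ∧
    (p * (x ^ (p - 1) * y) = (p - 1) * x ^ p + y ^ p → x = y) := by
  rcases hx.eq_or_lt with rfl | hx
  · rw [Real.zero_rpow (by linarith : p - 1 ≠ 0), Real.zero_rpow (by linarith : p ≠ 0)]
    have := Real.rpow_nonneg hy p
    refine ⟨by linarith, fun h => ?_⟩
    have h2 : y ^ p = 0 := by linarith
    exact ((Real.rpow_eq_zero hy (by linarith)).1 h2).symm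
  · have hxp : 0 < x ^ p := Real.rpow_pos_of_pos hx p
    have e1 : x ^ (p - 1) * y = x ^ p * (y / x) := by
      rw [Real.rpow_sub_one hx.ne']; ring
    have e2 : y ^ p = x ^ p * (1 + (y / x - 1)) ^ p := by
      rw [add_sub_cancel, Real.div_rpow hy hx.le]; field_simp
    have hs : -1 ≤ y / x - 1 := by have := div_nonneg hy hx.le; linarith
    constructor
    · have := one_add_mul_self_le_rpow_one_add hs (by linarith : 1 ≤ p)
      rw [e1, e2]
      nlinarith [mul_le_mul_of_nonneg_left this hxp.le]
    · intro h
      by_contra hne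
      have hs' : y / x - 1 ≠ 0 := by
        intro h0
        apply hne
        have : y / x = 1 := by linarith
        field_simp at this
        exact this.symm
      have := one_add_mul_self_lt_rpow_one_add hs hs' (by linarith : 1 < p)
      rw [e1, e2] at h
      nlinarith [mul_lt_mul_of_pos_left this hxp]

/-- Tail integral. -/
noncomputable def tailI (g : ℝ → ℝ) (r : ℝ) : ℝ := ∫ t in r..1, g t

lemma tailI_deriv (g : ℝ → ℝ) (hg : Continuous g) (r : ℝ) : HasDerivAt (tailI g) (-g r) r := by
  have h1 : HasDerivAt (fun r => ∫ t in (1:ℝ)..r, g t) (g r) r :=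
    intervalIntegral.integral_hasDerivAt_right (hg.intervalIntegrable _ _)
      hg.aestronglyMeasurable.stronglyMeasurableAtFilter hg.continuousAt
  have : tailI g = fun r => -∫ t in (1:ℝ)..r, g t := by
    funext r; rw [tailI, intervalIntegral.integral_symm]
  rw [this]; exact h1.neg

lemma tailI_cont (g : ℝ → ℝ) (hg : Continuous g) : Continuous (tailI g) :=
  continuous_iff_continuousAt.2 fun r => (tailI_deriv g hg r).continuousAt

lemma tailI_one (g : ℝ → ℝ) : tailI g 1 = 0 := by simp [tailI]

lemma tailI_nonneg (g : ℝ → ℝ) (h0 : ∀ r, 0 ≤ g r) (r : ℝ) (hr : r ≤ 1) : 0 ≤ tailI g r :=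
  intervalIntegral.integral_nonneg hr fun x _ => h0 x

/-- compactness -/
lemma compact_aux (g : ℕ → ℝ → ℝ) (hg : ∀ n, Continuous (g n)) (h0 : ∀ n r, 0 ≤ g n r)
    (M : ℝ) (hM : ∀ n, ∫ r in (0:ℝ)..1, (g n r) ^ 2 ≤ M) :
    ∃ (φ : ℕ → ℕ) (v : ℝ → ℝ) (C : ℝ), StrictMono φ ∧ Continuous v ∧
      (∀ x ∈ Icc (0:ℝ) 1, Tendsto (fun n => tailI (g (φ n)) x) atTop (𝓝 (v x))) ∧
      (∀ n, ∀ x ∈ Icc (0:ℝ) 1, tailI (g n) x ≤ C) := by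
  have hM0 : 0 ≤ M := le_trans (intervalIntegral.integral_nonneg zero_le_one
    fun x _ => sq_nonneg _) (hM 0)
  -- basic increment bound
  have key : ∀ n, ∀ K > 0, ∀ x ∈ Icc (0:ℝ) 1, ∀ y ∈ Icc (0:ℝ) 1, x ≤ y →
      ∫ t in x..y, g n t ≤ K * (y - x) + M / K := by
    intro n K hK x hx y hy hxy
    have hi : ∀ a b : ℝ, IntervalIntegrable (fun t => (g n t)^2) MeasureTheory.volume a b :=
      fun a b => ((hg n).pow 2).intervalIntegrable a b
    have h1 : ∫ t in x..y, g n t ≤ ∫ t in x..y, (K + (g n t)^2 / K) := by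
      apply intervalIntegral.integral_mono_on hxy ((hg n).intervalIntegrable _ _)
      · exact (continuous_const.add (((hg n).pow 2).div_const K)).intervalIntegrable _ _
      · intro t _
        have : K + g n t ^ 2 / K - g n t = ((g n t - K/2)^2 + 3/4*K^2) / K := by field_simp; ring
        have : 0 ≤ ((g n t - K/2)^2 + 3/4*K^2) / K := by positivity
        linarith
    have h2 : ∫ t in x..y, (K + (g n t)^2 / K) = K * (y - x) + (∫ t in x..y, (g n t)^2) / K := by
      rw [intervalIntegral.integral_add (by simp) ((hi _ _).div_const K)]
      simp; ring
    have h3 : ∫ t in x..y, (g n t)^2 ≤ ∫ t in (0:ℝ)..1, (g n t)^2 :=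
      intervalIntegral.integral_mono_interval hx.1 hxy hy.2
        (MeasureTheory.ae_of_all _ fun t => sq_nonneg _) (hi _ _)
    have h4 : (∫ t in x..y, (g n t)^2) / K ≤ M / K :=
      div_le_div_of_nonneg_right (h3.trans (hM n)) hK.le
    linarith
  have hsub : ∀ n (x y : ℝ), tailI (g n) x - tailI (g n) y = ∫ t in x..y, g n t := by
    intro n x y
    unfold tailI
    rw [← intervalIntegral.integral_add_adjacent_intervals ((hg n).intervalIntegrable x y)
      ((hg n).intervalIntegrable y 1)]
    ring
  have hbd : ∀ n, ∀ x ∈ Icc (0:ℝ) 1, tailI (g n) x ≤ 1 + M := by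
    intro n x hx
    have := key n 1 one_pos x hx 1 (by simp) hx.2
    unfold tailI
    have := hx.1
    linarith
  let F : ℕ → BoundedContinuousFunction (Icc (0:ℝ) 1) ℝ := fun n =>
    BoundedContinuousFunction.mkOfCompact ⟨fun x => tailI (g n) x,
      (tailI_cont _ (hg n)).comp continuous_subtype_val⟩
  have hF : ∀ n x, F n x = tailI (g n) x := fun n x => rfl
  have hc : IsCompact (closure (range F)) := by
    apply BoundedContinuousFunction.arzela_ascoli (Icc 0 (1 + M)) isCompact_Icc
    · rintro f x ⟨n, rfl⟩
      exact ⟨tailI_nonneg _ (h0 n) _ x.2.2, hbd n x x.2⟩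
    · intro x0
      rw [Metric.equicontinuousAt_iff]
      intro ε hε
      obtain ⟨K, hK, hK2⟩ : ∃ K : ℝ, 0 < K ∧ M / K < ε / 2 := by
        refine ⟨(M + 1) * 2 / ε, by positivity, ?_⟩
        rw [div_lt_iff₀ (by positivity)]
        field_simp
        linarith
      refine ⟨ε / (2 * K), by positivity, ?_⟩
      rintro x hx ⟨_, n, rfl⟩
      have hd : |(x:ℝ) - x0| < ε / (2 * K) := hx
      have hd2 : K * |(x:ℝ) - x0| < ε / 2 := by
        rw [lt_div_iff₀ (by positivity)] at hd
        linarith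
      change dist (tailI (g n) x0) (tailI (g n) x) < ε
      rw [Real.dist_eq]
      rcases le_total (x:ℝ) x0 with h | h
      · rw [abs_sub_comm, hsub, abs_of_nonneg (intervalIntegral.integral_nonneg h fun t _ => h0 n t)]
        have := key n K hK x x.2 x0 x0.2 h
        rw [abs_of_nonpos (by linarith)] at hd2
        linarith
      · rw [hsub, abs_of_nonneg (intervalIntegral.integral_nonneg h fun t _ => h0 n t)]
        have := key n K hK x0 x0.2 x x.2 h
        rw [abs_of_nonneg (by linarith)] at hd2
        linarith
  obtain ⟨f, -, φ, hφ, hlim⟩ := hc.tendsto_subseq (x := F) fun n => subset_closure ⟨n, rfl⟩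
  refine ⟨φ, IccExtend zero_le_one f, 1 + M, hφ, f.continuous.Icc_extend', ?_, hbd⟩
  intro x hx
  rw [IccExtend_of_mem _ _ hx]
  have hev : Continuous fun q : BoundedContinuousFunction (Icc (0:ℝ) 1) ℝ => q ⟨x, hx⟩ := by
    fun_prop
  have := (hev.tendsto f).comp hlim
  exact this

lemma dense_aux (W f : ℝ → ℝ)
    (hWd : ∀ s t : ℝ, 0 ≤ s → s < t → t ≤ 1 → ∃ r ∈ Ioo s t, 0 < W r)
    (hf : ContinuousOn f (Icc 0 1)) (r0 : ℝ) (hr0 : r0 ∈ Icc (0:ℝ) 1) (hne : f r0 ≠ 0) :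
    ∃ r ∈ Ioo (0:ℝ) 1, 0 < W r ∧ f r ≠ 0 := by
  have h1 : ∀ᶠ x in 𝓝[Icc 0 1] r0, f x ≠ 0 := (hf r0 hr0).eventually_ne hne
  obtain ⟨δ, hδ, hb⟩ := Metric.mem_nhdsWithin_iff.1 h1
  obtain ⟨r, hr, hW⟩ := hWd (max 0 (r0 - δ)) (min 1 (r0 + δ)) (le_max_left _ _)
    (by
      have := hr0.1
      have := hr0.2
      apply max_lt <;> apply lt_min <;> linarith) (min_le_left _ _)
  obtain ⟨h2, h3⟩ := hr
  rw [max_lt_iff] at h2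
  rw [lt_min_iff] at h3
  refine ⟨r, ⟨h2.1, h3.1⟩, hW, hb ⟨?_, h2.1.le, h3.1.le⟩⟩
  rw [Metric.mem_ball, Real.dist_eq, abs_lt]
  constructor <;> linarith

lemma exist_core (p : ℝ) (hp : 2 ≤ p) (W : ℝ → ℝ) (hW : Continuous W) (hW0 : ∀ r, 0 ≤ W r)
    (hWd : ∀ s t : ℝ, 0 ≤ s → s < t → t ≤ 1 → ∃ r ∈ Ioo s t, 0 < W r) (η : ℝ) (hη : 0 < η)
    (hlow : ∀ g : ℝ → ℝ, Continuous g → (∀ r, 0 ≤ g r) → g 0 = 0 →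
      η * (p - 1) * ∫ r in (0:ℝ)..1, W r * tailI g r ^ p ≤ ∫ r in (0:ℝ)..1, g r ^ p)
    (hmin : ∀ n : ℕ, ∃ g : ℝ → ℝ, Continuous g ∧ (∀ r, 0 ≤ g r) ∧
      ∫ r in (0:ℝ)..1, W r * tailI g r ^ p = 1 ∧
      ∫ r in (0:ℝ)..1, g r ^ p ≤ (η + 1 / ((n:ℝ) + 1)) * (p - 1)) :
    ∃ h : ℝ → ℝ, Continuous h ∧ (∀ r, 0 ≤ h r) ∧ h 0 = 0 ∧
      (∀ r ∈ Icc (0:ℝ) 1, h r ^ (p - 1) =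
        ∫ t in (0:ℝ)..r, η * (p - 1) * W t * tailI h t ^ (p - 1)) ∧
      (∃ r ∈ Icc (0:ℝ) 1, tailI h r ≠ 0) := by
  have hp0 : 0 ≤ p := by linarith
  have hp1 : 0 < p - 1 := by linarith
  have rc : ∀ {f : ℝ → ℝ} {s : ℝ}, Continuous f → 0 ≤ s → Continuous fun x => f x ^ s :=
    fun hf hs => hf.rpow_const fun _ => Or.inr hs
  choose g hg hg0 hg1 hgp using hmin
  have hM : ∀ n, ∫ r in (0:ℝ)..1, (g n r) ^ 2 ≤ 1 + (η + 1) * (p - 1) := by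
    intro n
    have h1 : ∫ r in (0:ℝ)..1, (g n r) ^ 2 ≤ ∫ r in (0:ℝ)..1, (1 + g n r ^ p) := by
      apply intervalIntegral.integral_mono_on zero_le_one
        (((hg n).pow 2).intervalIntegrable _ _)
        ((continuous_const.add (rc (hg n) hp0)).intervalIntegrable _ _)
      intro x _
      have h0 := hg0 n x
      change g n x ^ 2 ≤ 1 + g n x ^ p
      rcases le_total (g n x) 1 with h | h
      · have := Real.rpow_nonneg h0 p
        nlinarith
      · have := Real.rpow_le_rpow_of_exponent_le h hp
        rw [Real.rpow_two] at this
        linarith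
    rw [intervalIntegral.integral_add (by simp) ((rc (hg n) hp0).intervalIntegrable _ _)] at h1
    have h2 : 1 / ((n:ℝ) + 1) ≤ 1 := by
      rw [div_le_one (by positivity)]
      have : (0:ℝ) ≤ n := n.cast_nonneg
      linarith
    have h3 := hgp n
    have : (η + 1 / ((n:ℝ) + 1)) * (p - 1) ≤ (η + 1) * (p - 1) :=
      mul_le_mul_of_nonneg_right (by linarith) hp1.le
    simp at h1
    simp at h3 this
    linarith
  obtain ⟨φ, v, C, hφ, hv, hlim, hC⟩ := compact_aux g hg hg0 _ hM
  have hU0 : ∀ n, ∀ x ∈ Icc (0:ℝ) 1, 0 ≤ tailI (g n) x :=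
    fun n x hx => tailI_nonneg _ (hg0 n) x hx.2
  have hv0 : ∀ x ∈ Icc (0:ℝ) 1, 0 ≤ v x := fun x hx =>
    ge_of_tendsto (hlim x hx) (Eventually.of_forall fun n => hU0 _ x hx)
  have hsubI : ∀ x, x ∈ uIoc (0:ℝ) 1 → x ∈ Icc (0:ℝ) 1 := by
    intro x hx
    rw [uIoc_of_le zero_le_one] at hx
    exact ⟨hx.1.le, hx.2⟩
  -- limits
  have hN : ∫ r in (0:ℝ)..1, W r * v r ^ p = 1 := by
    have : Tendsto (fun n => ∫ r in (0:ℝ)..1, W r * tailI (g (φ n)) r ^ p) atTop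
        (𝓝 (∫ r in (0:ℝ)..1, W r * v r ^ p)) := by
      apply intervalIntegral.tendsto_integral_filter_of_dominated_convergence (fun r => W r * C ^ p)
      · exact Eventually.of_forall fun n =>
          (hW.mul (rc (tailI_cont _ (hg _)) hp0)).aestronglyMeasurable
      · refine Eventually.of_forall fun n => MeasureTheory.ae_of_all _ fun x hx => ?_
        have hx := hsubI x hx
        rw [Real.norm_of_nonneg (mul_nonneg (hW0 x) (Real.rpow_nonneg (hU0 _ x hx) p))]
        exact mul_le_mul_of_nonneg_left
          (Real.rpow_le_rpow (hU0 _ x hx) (hC _ x hx) hp0) (hW0 x)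
      · exact (hW.mul continuous_const).intervalIntegrable _ _
      · refine MeasureTheory.ae_of_all _ fun x hx => ?_
        exact ((hlim x (hsubI x hx)).rpow_const (Or.inr hp0)).const_mul _
    simp only [hg1] at this
    exact (tendsto_nhds_unique this tendsto_const_nhds)
  have hL : Tendsto (fun n => ∫ r in (0:ℝ)..1, W r * v r ^ (p - 1) * tailI (g (φ n)) r) atTop
        (𝓝 1) := by
    have : Tendsto (fun n => ∫ r in (0:ℝ)..1, W r * v r ^ (p - 1) * tailI (g (φ n)) r) atTop
        (𝓝 (∫ r in (0:ℝ)..1, W r * v r ^ (p - 1) * v r)) := by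
      apply intervalIntegral.tendsto_integral_filter_of_dominated_convergence
        (fun r => W r * v r ^ (p - 1) * C)
      · exact Eventually.of_forall fun n =>
          ((hW.mul (rc hv hp1.le)).mul (tailI_cont _ (hg _))).aestronglyMeasurable
      · refine Eventually.of_forall fun n => MeasureTheory.ae_of_all _ fun x hx => ?_
        have hx := hsubI x hx
        have h1 := mul_nonneg (hW0 x) (Real.rpow_nonneg (hv0 x hx) (p - 1))
        rw [Real.norm_of_nonneg (mul_nonneg h1 (hU0 _ x hx))]
        exact mul_le_mul_of_nonneg_left (hC _ x hx) h1
      · exact ((hW.mul (rc hv hp1.le)).mul continuous_const).intervalIntegrable _ _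
      · refine MeasureTheory.ae_of_all _ fun x hx => ?_
        exact (hlim x (hsubI x hx)).const_mul _
    convert this using 2
    refine hN.symm.trans ?_
    apply intervalIntegral.integral_congr
    intro x hx
    rw [uIcc_of_le zero_le_one] at hx
    have h0 := hv0 x hx
    change W x * v x ^ p = W x * v x ^ (p - 1) * v x
    rw [mul_assoc]
    congr 1
    rcases h0.eq_or_lt with h | h
    · rw [← h, Real.zero_rpow (by linarith)]; ring
    · rw [Real.rpow_sub_one h.ne']; field_simp
  -- the function G
  set k : ℝ → ℝ := fun t => η * (p - 1) * W t * v t ^ (p - 1) with hk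
  have hkc : Continuous k := (continuous_const.mul hW).mul (rc hv hp1.le)
  have hk0 : ∀ t ∈ Icc (0:ℝ) 1, 0 ≤ k t := fun t ht =>
    mul_nonneg (mul_nonneg (by positivity) (hW0 t)) (Real.rpow_nonneg (hv0 t ht) _)
  set G : ℝ → ℝ := fun r => ∫ t in (0:ℝ)..r, k t with hG
  have hGd : ∀ r, HasDerivAt G (k r) r := fun r =>
    intervalIntegral.integral_hasDerivAt_right (hkc.intervalIntegrable _ _)
      hkc.aestronglyMeasurable.stronglyMeasurableAtFilter hkc.continuousAt
  have hGc : Continuous G := continuous_iff_continuousAt.2 fun r => (hGd r).continuousAt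
  have hG0 : G 0 = 0 := by simp [hG]
  have hGn : ∀ r ∈ Icc (0:ℝ) 1, 0 ≤ G r := fun r hr =>
    intervalIntegral.integral_nonneg hr.1 fun t ht => hk0 t ⟨ht.1, ht.2.trans hr.2⟩
  set h : ℝ → ℝ := fun r => |G r| ^ (1 / (p - 1)) with hh
  have hhc : Continuous h := rc hGc.abs (by positivity)
  have hh0 : ∀ r, 0 ≤ h r := fun r => Real.rpow_nonneg (abs_nonneg _) _
  have hhz : h 0 = 0 := by
    simp only [hh, hG0, abs_zero]
    exact Real.zero_rpow (by positivity)
  have hhG : ∀ r ∈ Icc (0:ℝ) 1, h r ^ (p - 1) = G r := by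
    intro r hr
    simp only [hh]
    rw [← Real.rpow_mul (abs_nonneg _), one_div_mul_cancel hp1.ne', Real.rpow_one,
      abs_of_nonneg (hGn r hr)]
  have ibp : ∀ q : ℝ → ℝ, Continuous q →
      ∫ r in (0:ℝ)..1, G r * q r = ∫ r in (0:ℝ)..1, k r * tailI q r := by
    intro q hq
    have := intervalIntegral.integral_mul_deriv_eq_deriv_mul (a := 0) (b := 1)
      (fun x _ => hGd x) (fun x _ => tailI_deriv q hq x) (hkc.intervalIntegrable _ _)
      (hq.neg.intervalIntegrable _ _)
    rw [tailI_one, hG0] at this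
    simp only [mul_neg, intervalIntegral.integral_neg] at this
    linarith
  have ibp2 : ∀ q : ℝ → ℝ, Continuous q →
      ∫ r in (0:ℝ)..1, G r * q r =
        η * (p - 1) * ∫ r in (0:ℝ)..1, W r * v r ^ (p - 1) * tailI q r := by
    intro q hq
    rw [ibp q hq, ← intervalIntegral.integral_const_mul]
    congr 1; funext r; simp only [hk]; ring
  have hH : ∫ r in (0:ℝ)..1, h r ^ p =
      η * (p - 1) * ∫ r in (0:ℝ)..1, W r * v r ^ (p - 1) * tailI h r := by
    rw [← ibp2 h hhc]
    apply intervalIntegral.integral_congr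
    intro x hx
    rw [uIcc_of_le zero_le_one] at hx
    change h x ^ p = G x * h x
    rw [← hhG x hx]
    rcases (hh0 x).eq_or_lt with e | e
    · rw [← e, Real.zero_rpow (by linarith)]; ring
    · rw [Real.rpow_sub_one e.ne']; field_simp
  have hYn : ∀ n, p * (η * (p - 1) * ∫ r in (0:ℝ)..1, W r * v r ^ (p - 1) * tailI (g n) r) ≤
      (p - 1) * (∫ r in (0:ℝ)..1, h r ^ p) + (η + 1 / ((n:ℝ) + 1)) * (p - 1) := by
    intro n
    rw [← ibp2 (g n) (hg n)]
    have : ∫ r in (0:ℝ)..1, p * (G r * g n r) ≤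
        ∫ r in (0:ℝ)..1, ((p - 1) * h r ^ p + g n r ^ p) := by
      apply intervalIntegral.integral_mono_on zero_le_one
        ((continuous_const.mul (hGc.mul (hg n))).intervalIntegrable _ _)
        (((continuous_const.mul (rc hhc hp0)).add (rc (hg n) hp0)).intervalIntegrable _ _)
      intro x hx
      change p * (G x * g n x) ≤ (p - 1) * h x ^ p + g n x ^ p
      rw [← hhG x hx]
      exact (young_aux p hp _ _ (hh0 x) (hg0 n x)).1
    have hi1 : IntervalIntegrable (fun r => (p - 1) * h r ^ p) MeasureTheory.volume 0 1 :=
      (continuous_const.mul (rc hhc hp0)).intervalIntegrable _ _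
    rw [intervalIntegral.integral_const_mul, intervalIntegral.integral_add hi1
      ((rc (hg n) hp0).intervalIntegrable _ _), intervalIntegral.integral_const_mul] at this
    linarith [hgp n]
  have hlimY : p * (η * (p - 1) * 1) ≤
      (p - 1) * (∫ r in (0:ℝ)..1, h r ^ p) + (η + 0) * (p - 1) := by
    refine le_of_tendsto_of_tendsto ((hL.const_mul _).const_mul _) (Tendsto.const_add _
      (Tendsto.mul_const _ (Tendsto.const_add _
        (tendsto_one_div_add_atTop_nhds_zero_nat.comp hφ.tendsto_atTop)))) ?_
    exact Eventually.of_forall fun n => hYn (φ n)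
  have hyc := tailI_cont h hhc
  have hy0 : ∀ x ∈ Icc (0:ℝ) 1, 0 ≤ tailI h x := fun x hx => tailI_nonneg _ hh0 x hx.2
  have hlowh := hlow h hhc hh0 hhz
  set J := ∫ r in (0:ℝ)..1, W r * v r ^ (p - 1) * tailI h r with hJ
  set Y := ∫ r in (0:ℝ)..1, W r * tailI h r ^ p with hY
  rw [hH] at hlimY hlowh
  have hη1 : 0 < η * (p - 1) := by positivity
  have hYJ : Y ≤ J := le_of_mul_le_mul_left hlowh hη1
  have h1J : 1 ≤ J := by
    have : (η * (p - 1) * (p - 1)) * 1 ≤ (η * (p - 1) * (p - 1)) * J := by linarith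
    exact le_of_mul_le_mul_left this (by positivity)
  set d : ℝ → ℝ := fun r => W r * ((p - 1) * v r ^ p + tailI h r ^ p
    - p * (v r ^ (p - 1) * tailI h r)) with hd
  have hdc : Continuous d := hW.mul (((continuous_const.mul (rc hv hp0)).add (rc hyc hp0)).sub
    (continuous_const.mul ((rc hv hp1.le).mul hyc)))
  have hdI : ∫ r in (0:ℝ)..1, d r = (p - 1) * 1 + Y - p * J := by
    suffices ∫ r in (0:ℝ)..1, d r = (p - 1) * (∫ r in (0:ℝ)..1, W r * v r ^ p) + Y - p * J by
      rw [this, hN]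
    rw [hY, hJ, ← intervalIntegral.integral_const_mul, ← intervalIntegral.integral_const_mul,
      ← intervalIntegral.integral_add, ← intervalIntegral.integral_sub]
    · congr 1; funext r; simp only [hd]; ring
    · exact ((continuous_const.mul (hW.mul (rc hv hp0))).add
        (hW.mul (rc hyc hp0))).intervalIntegrable _ _
    · exact (continuous_const.mul ((hW.mul (rc hv hp1.le)).mul hyc)).intervalIntegrable _ _
    · exact (continuous_const.mul (hW.mul (rc hv hp0))).intervalIntegrable _ _
    · exact (hW.mul (rc hyc hp0)).intervalIntegrable _ _
  have hdn : ∀ x ∈ Icc (0:ℝ) 1, 0 ≤ d x := fun x hx =>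
    mul_nonneg (hW0 x) (by
      have := (young_aux p hp _ _ (hv0 x hx) (hy0 x hx)).1
      linarith)
  have hveq : ∀ x ∈ Icc (0:ℝ) 1, v x = tailI h x := by
    intro x hx
    by_contra hne
    obtain ⟨r, hr, hWr, hfr⟩ := dense_aux W (fun x => v x - tailI h x) hWd
      (hv.sub hyc).continuousOn x hx (sub_ne_zero.2 hne)
    have hr' : r ∈ Icc (0:ℝ) 1 := ⟨hr.1.le, hr.2.le⟩
    have hpos : 0 < ∫ r in (0:ℝ)..1, d r := by
      apply intervalIntegral.integral_pos zero_lt_one hdc.continuousOn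
        (fun x hx => hdn x ⟨hx.1.le, hx.2⟩)
      refine ⟨r, hr', mul_pos hWr ?_⟩
      obtain ⟨h1, h2⟩ := young_aux p hp _ _ (hv0 r hr') (hy0 r hr')
      have : p * (v r ^ (p - 1) * tailI h r) ≠ (p - 1) * v r ^ p + tailI h r ^ p :=
        fun e => hfr (sub_eq_zero.2 (h2 e))
      have := lt_of_le_of_ne h1 this
      linarith
    rw [hdI] at hpos
    nlinarith
  refine ⟨h, hhc, hh0, hhz, ?_, ?_⟩
  · intro r hr
    rw [hhG r hr]
    apply intervalIntegral.integral_congr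
    intro t ht
    rw [uIcc_of_le hr.1] at ht
    simp only [hk]
    rw [hveq t ⟨ht.1, ht.2.trans hr.2⟩]
  · by_contra! hcon
    have : ∫ r in (0:ℝ)..1, W r * v r ^ p = ∫ r in (0:ℝ)..1, (0:ℝ) := by
      apply intervalIntegral.integral_congr
      intro t ht
      rw [uIcc_of_le zero_le_one] at ht
      simp only [hveq t ht, hcon t ht]
      rw [Real.zero_rpow (by linarith)]; ring
    rw [hN] at this
    simp at this

lemma reduce_aux (v v' : ℝ → ℝ) (hc : ContinuousOn v' (Icc 0 1))
    (hd : ∀ r ∈ Icc (0:ℝ) 1, HasDerivWithinAt v (v' r) (Icc 0 1) r)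
    (h0 : v' 0 = 0) (h1 : v 1 = 0) :
    ∃ g : ℝ → ℝ, Continuous g ∧ (∀ r, 0 ≤ g r) ∧ g 0 = 0 ∧ (∀ r ∈ Icc (0:ℝ) 1, g r = |v' r|) ∧
      ∀ r ∈ Icc (0:ℝ) 1, |v r| ≤ tailI g r := by
  have hgc : Continuous (IccExtend (zero_le_one (α := ℝ)) (fun x : Icc (0:ℝ) 1 => |v' x|)) := by
    apply Continuous.Icc_extend'
    exact (continuousOn_iff_continuous_domRestrict.1 hc).abs
  have hge : ∀ r ∈ Icc (0:ℝ) 1,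
      IccExtend (zero_le_one (α := ℝ)) (fun x : Icc (0:ℝ) 1 => |v' x|) r = |v' r| :=
    fun r hr => IccExtend_of_mem _ _ hr
  refine ⟨_, hgc, fun r => abs_nonneg _, ?_, hge, ?_⟩
  · rw [hge 0 (by simp), h0, abs_zero]
  · intro r hr
    have hsub : Icc r 1 ⊆ Icc (0:ℝ) 1 := Icc_subset_Icc_left hr.1
    have hvc : ContinuousOn v (Icc 0 1) := fun x hx => (hd x hx).continuousWithinAt
    have hi : IntervalIntegrable v' MeasureTheory.volume r 1 := by
      apply ContinuousOn.intervalIntegrable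
      rw [uIcc_of_le hr.2]; exact hc.mono hsub
    have := intervalIntegral.integral_eq_sub_of_hasDerivAt_of_le hr.2 (hvc.mono hsub)
      (fun x hx => (hd x (hsub ⟨hx.1.le, hx.2.le⟩)).hasDerivAt
        (Icc_mem_nhds (lt_of_le_of_lt hr.1 hx.1) hx.2)) hi
    rw [h1, zero_sub] at this
    rw [← abs_neg, ← this]
    refine (intervalIntegral.abs_integral_le_integral_abs hr.2).trans (le_of_eq ?_)
    apply intervalIntegral.integral_congr
    intro t ht
    rw [uIcc_of_le hr.2] at ht
    exact (hge t (hsub ht)).symm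

lemma picone_core (p : ℝ) (hp : 2 ≤ p) (W : ℝ → ℝ) (hW : Continuous W) (hW0 : ∀ r, 0 ≤ W r)
    (l : ℝ) (hl : 0 ≤ l) (v v' : ℝ → ℝ) (hc : ContinuousOn v' (Icc 0 1))
    (hd : ∀ r ∈ Icc (0:ℝ) 1, HasDerivWithinAt v (v' r) (Icc 0 1) r)
    (hG : ∀ r ∈ Ioo (0:ℝ) 1, HasDerivAt (fun t => |v' t| ^ (p - 2) * v' t)
      (-(l * W r * (|v r| ^ (p - 2) * v r))) r)
    (h0 : v' 0 = 0) (h1 : v 1 = 0) (hpos : ∀ r ∈ Ioo (0:ℝ) 1, 0 < v r)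
    (g : ℝ → ℝ) (hg : Continuous g) (hg0 : ∀ r, 0 ≤ g r) :
    l * ∫ r in (0:ℝ)..1, W r * tailI g r ^ p ≤ ∫ r in (0:ℝ)..1, g r ^ p := by
  have hp0 : 0 ≤ p := by linarith
  have hp1 : 0 < p - 1 := by linarith
  have hp2 : 0 ≤ p - 2 := by linarith
  have hvc : ContinuousOn v (Icc 0 1) := fun x hx => (hd x hx).continuousWithinAt
  have hda : ∀ r ∈ Ioo (0:ℝ) 1, HasDerivAt v (v' r) r := fun r hr =>
    (hd r ⟨hr.1.le, hr.2.le⟩).hasDerivAt (Icc_mem_nhds hr.1 hr.2)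
  set Φ : ℝ → ℝ := fun t => |v' t| ^ (p - 2) * v' t with hΦ
  have hΦc : ContinuousOn Φ (Icc 0 1) :=
    (hc.abs.rpow_const fun _ _ => Or.inr hp2).mul hc
  have hΦ0 : Φ 0 = 0 := by simp [hΦ, h0]
  have hanti : AntitoneOn Φ (Icc 0 1) := by
    apply antitoneOn_of_deriv_nonpos (convex_Icc 0 1) hΦc
    · rw [interior_Icc]
      exact fun x hx => (hG x hx).differentiableAt.differentiableWithinAt
    · rw [interior_Icc]
      intro x hx
      rw [(hG x hx).deriv]
      have h2 := (hpos x hx).le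
      have := mul_nonneg (mul_nonneg hl (hW0 x)) (mul_nonneg (Real.rpow_nonneg (abs_nonneg (v x)) (p-2)) h2)
      linarith
  have hv'n : ∀ r ∈ Icc (0:ℝ) 1, v' r ≤ 0 := by
    intro r hr
    by_contra! h
    have h2 := hanti (by simp) hr hr.1
    rw [hΦ0] at h2
    have : 0 < Φ r := mul_pos (Real.rpow_pos_of_pos (abs_pos.2 h.ne') _) h
    linarith
  have hv0 : ∀ r ∈ Icc (0:ℝ) 1, 0 ≤ v r := by
    have : AntitoneOn v (Icc 0 1) := by
      apply antitoneOn_of_deriv_nonpos (convex_Icc 0 1) hvc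
      · rw [interior_Icc]
        exact fun x hx => (hda x hx).differentiableAt.differentiableWithinAt
      · rw [interior_Icc]
        intro x hx
        rw [(hda x hx).deriv]
        exact hv'n x ⟨hx.1.le, hx.2.le⟩
    intro r hr
    rw [← h1]
    exact this hr (by simp) hr.2
  have huc := tailI_cont g hg
  have hu0 : ∀ x ∈ Icc (0:ℝ) 1, 0 ≤ tailI g x := fun x hx => tailI_nonneg _ hg0 x hx.2
  set u := tailI g with hu
  have hupc : Continuous fun r => u r ^ p := huc.rpow_const fun _ => Or.inr hp0
  have hgpc : Continuous fun r => g r ^ p := hg.rpow_const fun _ => Or.inr hp0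
  -- the regularised inequality
  have hmc : ∀ ε : ℝ, 0 < ε → ContinuousOn
      (fun r => l * W r * u r ^ p * (v r / (v r + ε)) ^ (p - 1) - g r ^ p) (Icc 0 1) := by
    intro ε hε
    refine ContinuousOn.sub (ContinuousOn.mul
      ((continuous_const.mul hW).mul hupc).continuousOn ?_) hgpc.continuousOn
    refine ContinuousOn.rpow_const ?_ fun _ _ => Or.inr hp1.le
    exact hvc.div (hvc.add continuousOn_const) fun x hx => by
      have := hv0 x hx
      positivity
  have hreg : ∀ ε : ℝ, 0 < ε →
      ∫ r in (0:ℝ)..1, (l * W r * u r ^ p * (v r / (v r + ε)) ^ (p - 1) - g r ^ p) ≤ 0 := by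
    intro ε hε
    have hs : ∀ x ∈ Icc (0:ℝ) 1, 0 < v x + ε := fun x hx => by
      have := hv0 x hx
      positivity
    have hFc : ContinuousOn (fun r => -Φ r * (u r ^ p * (v r + ε) ^ (1 - p))) (Icc 0 1) := by
      refine hΦc.neg.mul (hupc.continuousOn.mul ?_)
      exact (hvc.add continuousOn_const).rpow_const fun x hx => Or.inl (hs x hx).ne'
    have hFd : ∀ x ∈ Ioo (0:ℝ) 1, HasDerivAt (fun r => -Φ r * (u r ^ p * (v r + ε) ^ (1 - p)))
        (-(-(l * W x * (|v x| ^ (p - 2) * v x))) * (u x ^ p * (v x + ε) ^ (1 - p)) +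
          -Φ x * ((-g x * p * u x ^ (p - 1)) * (v x + ε) ^ (1 - p) +
            u x ^ p * (v' x * (1 - p) * (v x + ε) ^ (1 - p - 1)))) x := by
      intro x hx
      have hx' : x ∈ Icc (0:ℝ) 1 := ⟨hx.1.le, hx.2.le⟩
      exact (hG x hx).neg.mul (((tailI_deriv g hg x).rpow_const (Or.inr (by linarith))).mul
        (((hda x hx).add_const ε).rpow_const (Or.inl (hs x hx').ne')))
    have := intervalIntegral.integral_le_sub_of_hasDeriv_right_of_le (zero_le_one (α := ℝ)) hFc
      (fun x hx => (hFd x hx).hasDerivWithinAt) ((hmc ε hε).integrableOn_Icc) (by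
        intro x hx
        have hx' : x ∈ Icc (0:ℝ) 1 := ⟨hx.1.le, hx.2.le⟩
        have hvx := hpos x hx
        have hsx := hs x hx'
        have hux := hu0 x hx'
        obtain ⟨h, hh⟩ : ∃ h, h = -v' x := ⟨_, rfl⟩
        have hv'x : v' x = -h := by rw [hh]; ring
        have hhn : 0 ≤ h := by have := hv'n x hx'; linarith
        have e1 : -Φ x = h ^ (p - 1) := by
          simp only [hΦ, hv'x, abs_neg, abs_of_nonneg hhn]
          rcases hhn.eq_or_lt with e | e
          · rw [← e, Real.zero_rpow hp1.ne']; ring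
          · rw [show p - 1 = (p - 2) + 1 by ring, Real.rpow_add_one e.ne']; ring
        have e2 : |v x| ^ (p - 2) * v x = v x ^ (p - 1) := by
          rw [abs_of_pos hvx, show p - 1 = (p - 2) + 1 by ring, Real.rpow_add_one hvx.ne']
        have e3 : (v x / (v x + ε)) ^ (p - 1) = v x ^ (p - 1) * (v x + ε) ^ (1 - p) := by
          rw [Real.div_rpow hvx.le hsx.le, show 1 - p = -(p - 1) by ring, Real.rpow_neg hsx.le]
          rfl
        have hY := (young_aux p hp (h * u x / (v x + ε)) (g x)
          (div_nonneg (mul_nonneg hhn hux) hsx.le) (hg0 x)).1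
        have e4 : (h * u x / (v x + ε)) ^ (p - 1) =
            h ^ (p - 1) * u x ^ (p - 1) * (v x + ε) ^ (1 - p) := by
          rw [Real.div_rpow (mul_nonneg hhn hux) hsx.le, Real.mul_rpow hhn hux,
            show 1 - p = -(p - 1) by ring, Real.rpow_neg hsx.le]
          rfl
        have e5 : (h * u x / (v x + ε)) ^ p =
            h ^ (p - 1) * h * u x ^ p * (v x + ε) ^ (1 - p - 1) := by
          rw [Real.div_rpow (mul_nonneg hhn hux) hsx.le, Real.mul_rpow hhn hux,
            show 1 - p - 1 = -p by ring, Real.rpow_neg hsx.le]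
          have : h ^ (p - 1) * h = h ^ p := by
            rcases hhn.eq_or_lt with e | e
            · rw [← e, Real.zero_rpow (by linarith : p ≠ 0)]; ring
            · rw [Real.rpow_sub_one e.ne']; field_simp
          rw [this]
          rfl
        rw [e4, e5] at hY
        rw [e1, e2, e3, hv'x]
        nlinarith [hY])
    refine this.trans (le_of_eq ?_)
    have hu1 : u 1 = 0 := tailI_one g
    simp only [hΦ0, hu1]
    rw [Real.zero_rpow (by linarith : p ≠ 0)]
    ring
  have hlim : Tendsto (fun n : ℕ => ∫ r in (0:ℝ)..1,
      (l * W r * u r ^ p * (v r / (v r + 1 / ((n:ℝ) + 1))) ^ (p - 1) - g r ^ p)) atTop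
      (𝓝 (∫ r in (0:ℝ)..1, (l * W r * u r ^ p - g r ^ p))) := by
    have hsubI : uIoc (0:ℝ) 1 ⊆ Icc 0 1 := by
      rw [uIoc_of_le zero_le_one]; exact Ioc_subset_Icc_self
    apply intervalIntegral.tendsto_integral_filter_of_dominated_convergence
      (fun r => l * W r * u r ^ p + g r ^ p)
    · exact Eventually.of_forall fun n =>
        ((hmc _ Nat.one_div_pos_of_nat).mono hsubI).aestronglyMeasurable measurableSet_uIoc
    · refine Eventually.of_forall fun n => MeasureTheory.ae_of_all _ fun x hx => ?_
      have hx := hsubI hx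
      have hε : (0:ℝ) < 1 / ((n:ℝ) + 1) := Nat.one_div_pos_of_nat
      have hvx := hv0 x hx
      have hA : 0 ≤ l * W x * u x ^ p :=
        mul_nonneg (mul_nonneg hl (hW0 x)) (Real.rpow_nonneg (hu0 x hx) p)
      have hB : 0 ≤ g x ^ p := Real.rpow_nonneg (hg0 x) p
      have hq0 : 0 ≤ v x / (v x + 1 / ((n:ℝ) + 1)) := by positivity
      have hq1 : v x / (v x + 1 / ((n:ℝ) + 1)) ≤ 1 := by
        rw [div_le_one (by positivity)]; linarith
      have hr1 := Real.rpow_le_one hq0 hq1 hp1.le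
      have hr0 := Real.rpow_nonneg hq0 (p - 1)
      rw [Real.norm_eq_abs, abs_le]
      constructor <;> nlinarith [mul_nonneg hA hr0, mul_le_mul_of_nonneg_left hr1 hA]
    · exact (((continuous_const.mul hW).mul hupc).add hgpc).intervalIntegrable _ _
    · refine MeasureTheory.ae_of_all _ fun x hx => ?_
      rw [uIoc_of_le zero_le_one] at hx
      rcases hx.2.eq_or_lt with e | e
      · have hu1 : u x = 0 := by rw [e]; exact tailI_one g
        simp only [hu1]
        rw [Real.zero_rpow (by linarith : p ≠ 0)]
        simp
      · have hvx := hpos x ⟨hx.1, e⟩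
        have h2 : Tendsto (fun n : ℕ => v x / (v x + 1 / ((n:ℝ) + 1))) atTop
            (𝓝 (v x / (v x + 0))) :=
          tendsto_const_nhds.div (tendsto_one_div_add_atTop_nhds_zero_nat.const_add _)
            (by simpa using hvx.ne')
        rw [add_zero, div_self hvx.ne'] at h2
        have h3 := ((h2.rpow_const (p := p - 1) (Or.inr hp1.le)).const_mul
          (l * W x * u x ^ p)).sub_const (g x ^ p)
        simpa using h3
  have hfin := le_of_tendsto hlim (Eventually.of_forall fun n => hreg _ Nat.one_div_pos_of_nat)
  have hi1 : IntervalIntegrable (fun r => l * W r * u r ^ p) MeasureTheory.volume 0 1 :=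
    ((continuous_const.mul hW).mul hupc).intervalIntegrable _ _
  rw [intervalIntegral.integral_sub hi1 (hgpc.intervalIntegrable _ _)] at hfin
  simp only [mul_assoc, intervalIntegral.integral_const_mul] at hfin
  linarith

lemma energy_aux (p : ℝ) (hp : 2 ≤ p) (a : ℝ → ℝ) (ha : ContinuousOn a (Icc 0 1))
    (μ : ℝ) (v v' : ℝ → ℝ) (hs : APSol p μ a v v') :
    ∫ r in (0:ℝ)..1, |v' r| ^ p =
      μ ^ (p - 1) * ((p - 1) * ∫ r in (0:ℝ)..1, r ^ (p - 2) * a r * |v r| ^ p) := by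
  obtain ⟨hc, hd, hG, h0, h1⟩ := hs
  have hp0 : 0 ≤ p := by linarith
  have hp2 : 0 ≤ p - 2 := by linarith
  have hvc : ContinuousOn v (Icc 0 1) := fun x hx => (hd x hx).continuousWithinAt
  have hpow : ∀ x : ℝ, |x| ^ p = |x| ^ (p - 2) * x * x := by
    intro x
    rcases eq_or_ne x 0 with rfl | hx
    · rw [abs_zero, Real.zero_rpow (by linarith)]; ring
    · have h2 : x * x = |x| ^ (2:ℝ) := by rw [Real.rpow_two, sq_abs]; ring
      rw [mul_assoc, h2, ← Real.rpow_add (abs_pos.2 hx)]; congr 1; ring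
  have hwc : ContinuousOn (fun r => r ^ (p - 2) * a r * |v r| ^ p) (Icc 0 1) :=
    ((continuousOn_id.rpow_const fun _ _ => Or.inr hp2).mul ha).mul
      (hvc.abs.rpow_const fun _ _ => Or.inr hp0)
  have hv'p : ContinuousOn (fun r => |v' r| ^ p) (Icc 0 1) :=
    hc.abs.rpow_const fun _ _ => Or.inr hp0
  have hint : ∀ f : ℝ → ℝ, ContinuousOn f (Icc 0 1) →
      IntervalIntegrable f MeasureTheory.volume 0 1 := by
    intro f hf
    apply ContinuousOn.intervalIntegrable
    rwa [uIcc_of_le zero_le_one]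
  have key := intervalIntegral.integral_eq_sub_of_hasDerivAt_of_le (zero_le_one (α := ℝ))
    (f := fun r => |v' r| ^ (p - 2) * v' r * v r)
    (f' := fun r => |v' r| ^ p - μ ^ (p - 1) * (p - 1) * (r ^ (p - 2) * a r * |v r| ^ p))
    (((hc.abs.rpow_const fun _ _ => Or.inr hp2).mul hc).mul hvc)
    (by
      intro x hx
      have h2 := (hG x hx).mul ((hd x ⟨hx.1.le, hx.2.le⟩).hasDerivAt (Icc_mem_nhds hx.1 hx.2))
      refine HasDerivAt.congr_deriv h2 ?_
      rw [hpow (v' x), hpow (v x)]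
      ring)
    (hint _ (hv'p.sub (continuousOn_const.mul hwc)))
  rw [intervalIntegral.integral_sub (hint _ hv'p) ((hint _ hwc).const_mul _),
    intervalIntegral.integral_const_mul, h1, h0] at key
  simp only [mul_zero, zero_mul, sub_zero] at key
  linarith

theorem stmt2 (p : ℝ) (hp : 2 ≤ p) (a : ℝ → ℝ)
    (ha : ContinuousOn a (Icc 0 1)) (ha0 : ∀ r ∈ Icc (0:ℝ) 1, 0 ≤ a r)
    (hanv : ∀ s t : ℝ, 0 ≤ s → s < t → t ≤ 1 → ∃ r ∈ Ioo s t, a r ≠ 0) :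
    (∀ μ : ℝ, 0 < μ → μ < mu1 a p →
      ∀ v v' : ℝ → ℝ, APSol p μ a v v' → ∀ r ∈ Icc (0:ℝ) 1, v r = 0) ∧
    (∀ μ : ℝ, 0 < μ →
      ((∃ v v' : ℝ → ℝ, APSol p μ a v v' ∧ ∀ r ∈ Ioo (0:ℝ) 1, 0 < v r) ↔ μ = mu1 a p)) := by
  have hp0 : 0 ≤ p := by linarith
  have hp1 : 0 < p - 1 := by linarith
  have hp2 : 0 ≤ p - 2 := by linarith
  -- the extended weight
  obtain ⟨W, hW, hWe, hW0⟩ : ∃ W : ℝ → ℝ, Continuous W ∧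
      (∀ r ∈ Icc (0:ℝ) 1, W r = r ^ (p - 2) * a r) ∧ ∀ r, 0 ≤ W r := by
    refine ⟨IccExtend (zero_le_one (α := ℝ)) (fun x : Icc (0:ℝ) 1 => (x:ℝ) ^ (p - 2) * a x),
      ?_, fun r hr => IccExtend_of_mem _ _ hr, ?_⟩
    · apply Continuous.Icc_extend'
      have : ContinuousOn (fun r : ℝ => r ^ (p - 2) * a r) (Icc 0 1) :=
        (continuousOn_id.rpow_const fun _ _ => Or.inr hp2).mul ha
      exact continuousOn_iff_continuous_domRestrict.1 this
    · intro r
      exact mul_nonneg (Real.rpow_nonneg (projIcc 0 1 zero_le_one r).2.1 _)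
        (ha0 _ (projIcc 0 1 zero_le_one r).2)
  have hWd : ∀ s t : ℝ, 0 ≤ s → s < t → t ≤ 1 → ∃ r ∈ Ioo s t, 0 < W r := by
    intro s t hs hst ht
    obtain ⟨r, hr, hne⟩ := hanv s t hs hst ht
    have hr0 : 0 < r := lt_of_le_of_lt hs hr.1
    have hr' : r ∈ Icc (0:ℝ) 1 := ⟨hr0.le, (hr.2.trans_le ht).le⟩
    refine ⟨r, hr, ?_⟩
    rw [hWe r hr']
    exact mul_pos (Real.rpow_pos_of_pos hr0 _) (lt_of_le_of_ne (ha0 r hr') hne.symm)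
  have hWI : ∀ f : ℝ → ℝ, ∫ r in (0:ℝ)..1, r ^ (p - 2) * a r * f r =
      ∫ r in (0:ℝ)..1, W r * f r := by
    intro f
    apply intervalIntegral.integral_congr
    intro x hx
    rw [uIcc_of_le zero_le_one] at hx
    simp only [hWe x hx]
  -- positivity of the denominator
  have hD : ∀ v : ℝ → ℝ, ContinuousOn v (Icc 0 1) → (∃ r ∈ Icc (0:ℝ) 1, v r ≠ 0) →
      0 < ∫ r in (0:ℝ)..1, W r * |v r| ^ p := by
    rintro v hv ⟨r, hr, hne⟩
    obtain ⟨x, hx, hWx, hvx⟩ := dense_aux W v hWd hv r hr hne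
    apply intervalIntegral.integral_pos zero_lt_one
      (hW.continuousOn.mul (hv.abs.rpow_const fun _ _ => Or.inr hp0))
      (fun y _ => mul_nonneg (hW0 y) (Real.rpow_nonneg (abs_nonneg _) _))
    exact ⟨x, ⟨hx.1.le, hx.2.le⟩, mul_pos hWx (Real.rpow_pos_of_pos (abs_pos.2 hvx) _)⟩
  set S : Set ℝ := { q : ℝ | ∃ v v' : ℝ → ℝ,
    ContinuousOn v' (Icc 0 1) ∧
    (∀ r ∈ Icc (0:ℝ) 1, HasDerivWithinAt v (v' r) (Icc 0 1) r) ∧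
    v' 0 = 0 ∧ v 1 = 0 ∧ (∃ r ∈ Icc (0:ℝ) 1, v r ≠ 0) ∧
    q = (∫ r in (0:ℝ)..1, |v' r| ^ p) /
        ((p - 1) * ∫ r in (0:ℝ)..1, r ^ (p - 2) * a r * |v r| ^ p) } with hS
  have hη : eta1 a p = sInf S := rfl
  have hS0 : ∀ q ∈ S, 0 ≤ q := by
    rintro q ⟨v, v', hc, hd, h0, h1, hne, rfl⟩
    have := hD v (fun x hx => (hd x hx).continuousWithinAt) hne
    rw [hWI]
    exact div_nonneg (intervalIntegral.integral_nonneg zero_le_one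
      fun x _ => Real.rpow_nonneg (abs_nonneg _) _) (by positivity)
  have hbdd : BddBelow S := ⟨0, hS0⟩
  have hη0 : 0 ≤ eta1 a p := Real.sInf_nonneg hS0
  -- any nontrivial solution gives an element of S
  have hsolS : ∀ μ v v', APSol p μ a v v' → (∃ r ∈ Icc (0:ℝ) 1, v r ≠ 0) → μ ^ (p - 1) ∈ S := by
    intro μ v v' hs hne
    have he := energy_aux p hp a ha μ v v' hs
    obtain ⟨hc, hd, hG, h0, h1⟩ := hs
    refine ⟨v, v', hc, hd, h0, h1, hne, ?_⟩
    rw [he]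
    have := hD v (fun x hx => (hd x hx).continuousWithinAt) hne
    rw [← hWI] at this
    rw [mul_div_cancel_right₀]
    exact (mul_pos hp1 this).ne'
  have hmuinv : ∀ μ : ℝ, 0 < μ → (μ ^ (p - 1)) ^ (1 / (p - 1)) = μ := by
    intro μ hμ
    rw [← Real.rpow_mul hμ.le, mul_one_div_cancel hp1.ne', Real.rpow_one]
  refine ⟨?_, ?_⟩
  · intro μ hμ hlt v v' hs
    by_contra! hne
    have h1 : eta1 a p ≤ μ ^ (p - 1) := csInf_le hbdd (hsolS μ v v' hs hne)
    have h2 := Real.rpow_le_rpow hη0 h1 (by positivity : 0 ≤ 1 / (p - 1))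
    rw [hmuinv μ hμ] at h2
    exact absurd hlt (not_lt.2 h2)
  · intro μ hμ
    constructor
    · rintro ⟨v, v', hs, hpos⟩
      have hmem := hsolS μ v v' hs ⟨1/2, by norm_num, (hpos _ (by norm_num)).ne'⟩
      have h1 : eta1 a p ≤ μ ^ (p - 1) := csInf_le hbdd hmem
      have h2 : μ ^ (p - 1) ≤ eta1 a p := by
        rw [hη]
        refine le_csInf ⟨_, hmem⟩ ?_
        rintro q ⟨w, w', wc, wd, w0, w1, wne, rfl⟩
        have wcc : ContinuousOn w (Icc 0 1) := fun x hx => (wd x hx).continuousWithinAt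
        have hDw := hD w wcc wne
        obtain ⟨g, hgc, hg0, -, hge, hgw⟩ := reduce_aux w w' wc wd w0 w1
        obtain ⟨hc, hd, hG, h0, h1⟩ := hs
        have hl : 0 ≤ μ ^ (p - 1) * (p - 1) := mul_nonneg (Real.rpow_nonneg hμ.le _) hp1.le
        have hpic := picone_core p hp W hW hW0 (μ ^ (p - 1) * (p - 1)) hl v v' hc hd
          (by
            intro r hr
            convert hG r hr using 2
            rw [hWe r ⟨hr.1.le, hr.2.le⟩]; ring) h0 h1 hpos g hgc hg0
        have e1 : ∫ r in (0:ℝ)..1, g r ^ p = ∫ r in (0:ℝ)..1, |w' r| ^ p := by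
          apply intervalIntegral.integral_congr
          intro x hx
          rw [uIcc_of_le zero_le_one] at hx
          simp only [hge x hx]
        have e2 : ∫ r in (0:ℝ)..1, W r * |w r| ^ p ≤ ∫ r in (0:ℝ)..1, W r * tailI g r ^ p := by
          apply intervalIntegral.integral_mono_on zero_le_one
          · apply ContinuousOn.intervalIntegrable
            rw [uIcc_of_le zero_le_one]
            exact hW.continuousOn.mul (wcc.abs.rpow_const fun _ _ => Or.inr hp0)
          · exact (hW.mul ((tailI_cont g hgc).rpow_const
              fun _ => Or.inr hp0)).intervalIntegrable _ _
          · intro x hx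
            exact mul_le_mul_of_nonneg_left
              (Real.rpow_le_rpow (abs_nonneg _) (hgw x hx) hp0) (hW0 x)
        rw [hWI, le_div_iff₀ (by positivity), ← e1]
        have := mul_le_mul_of_nonneg_left e2 hl
        linarith
      rw [mu1, le_antisymm h1 h2, hmuinv μ hμ]
    · intro hμe
      have hηpos : 0 < eta1 a p := by
        refine lt_of_le_of_ne hη0 fun h => ?_
        rw [mu1, ← h, Real.zero_rpow (by positivity)] at hμe
        linarith
      have hμη : μ ^ (p - 1) = eta1 a p := by
        rw [hμe, mu1, ← Real.rpow_mul hη0, one_div_mul_cancel hp1.ne', Real.rpow_one]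
      have hSne : S.Nonempty := by
        by_contra! h
        rw [hη, h, Real.sInf_empty] at hηpos
        exact lt_irrefl _ hηpos
      have hlow : ∀ g : ℝ → ℝ, Continuous g → (∀ r, 0 ≤ g r) → g 0 = 0 →
          eta1 a p * (p - 1) * ∫ r in (0:ℝ)..1, W r * tailI g r ^ p ≤
            ∫ r in (0:ℝ)..1, g r ^ p := by
        intro g hgc hg0 hgz
        have hgI : 0 ≤ ∫ r in (0:ℝ)..1, g r ^ p :=
          intervalIntegral.integral_nonneg zero_le_one fun x _ => Real.rpow_nonneg (hg0 x) _
        have e2 : ∫ r in (0:ℝ)..1, W r * tailI g r ^ p =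
            ∫ r in (0:ℝ)..1, W r * |tailI g r| ^ p := by
          apply intervalIntegral.integral_congr
          intro x hx
          rw [uIcc_of_le zero_le_one] at hx
          simp only [abs_of_nonneg (tailI_nonneg g hg0 x hx.2)]
        by_cases hne : ∃ r ∈ Icc (0:ℝ) 1, tailI g r ≠ 0
        · have hDp := hD (tailI g) (tailI_cont g hgc).continuousOn hne
          have hmem : (∫ r in (0:ℝ)..1, |(-g r)| ^ p) /
              ((p - 1) * ∫ r in (0:ℝ)..1, r ^ (p - 2) * a r * |tailI g r| ^ p) ∈ S :=
            ⟨tailI g, fun r => -g r, hgc.neg.continuousOn,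
              fun r _ => (tailI_deriv g hgc r).hasDerivWithinAt, by simp [hgz], tailI_one g, hne,
              rfl⟩
          have := csInf_le hbdd hmem
          rw [← hη, hWI, le_div_iff₀ (by positivity)] at this
          have e1 : ∫ r in (0:ℝ)..1, |(-g r)| ^ p = ∫ r in (0:ℝ)..1, g r ^ p := by
            congr 1; funext r; rw [abs_neg, abs_of_nonneg (hg0 r)]
          rw [e1] at this
          rw [e2]
          linarith
        · push Not at hne
          have : ∫ r in (0:ℝ)..1, W r * tailI g r ^ p = ∫ r in (0:ℝ)..1, (0:ℝ) := by
            apply intervalIntegral.integral_congr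
            intro x hx
            rw [uIcc_of_le zero_le_one] at hx
            simp only [hne x hx]
            rw [Real.zero_rpow (by linarith)]; ring
          rw [this]
          simpa using hgI
      have hmin : ∀ n : ℕ, ∃ g : ℝ → ℝ, Continuous g ∧ (∀ r, 0 ≤ g r) ∧
          ∫ r in (0:ℝ)..1, W r * tailI g r ^ p = 1 ∧
          ∫ r in (0:ℝ)..1, g r ^ p ≤ (eta1 a p + 1 / ((n:ℝ) + 1)) * (p - 1) := by
        intro n
        have hlt : sInf S < eta1 a p + 1 / ((n:ℝ) + 1) := by
          rw [← hη]
          have : (0:ℝ) < 1 / ((n:ℝ) + 1) := Nat.one_div_pos_of_nat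
          linarith
        obtain ⟨q, hqS, hq⟩ := exists_lt_of_csInf_lt hSne hlt
        have hq0 := hS0 q hqS
        obtain ⟨w, w', wc, wd, w0, w1, wne, hqe⟩ := hqS
        have wcc : ContinuousOn w (Icc 0 1) := fun x hx => (wd x hx).continuousWithinAt
        have hDw := hD w wcc wne
        obtain ⟨g, hgc, hg0, -, hge, hgw⟩ := reduce_aux w w' wc wd w0 w1
        have e1 : ∫ r in (0:ℝ)..1, g r ^ p = ∫ r in (0:ℝ)..1, |w' r| ^ p := by
          apply intervalIntegral.integral_congr
          intro x hx
          rw [uIcc_of_le zero_le_one] at hx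
          simp only [hge x hx]
        have e2 : ∫ r in (0:ℝ)..1, W r * |w r| ^ p ≤ ∫ r in (0:ℝ)..1, W r * tailI g r ^ p := by
          apply intervalIntegral.integral_mono_on zero_le_one
          · apply ContinuousOn.intervalIntegrable
            rw [uIcc_of_le zero_le_one]
            exact hW.continuousOn.mul (wcc.abs.rpow_const fun _ _ => Or.inr hp0)
          · exact (hW.mul ((tailI_cont g hgc).rpow_const
              fun _ => Or.inr hp0)).intervalIntegrable _ _
          · intro x hx
            exact mul_le_mul_of_nonneg_left
              (Real.rpow_le_rpow (abs_nonneg _) (hgw x hx) hp0) (hW0 x)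
        rw [hWI, ← e1, eq_div_iff (by positivity)] at hqe
        set N := ∫ r in (0:ℝ)..1, W r * tailI g r ^ p with hN
        have hNpos : 0 < N := lt_of_lt_of_le hDw e2
        set c := (N⁻¹) ^ (1 / p) with hc
        have hc0 : 0 ≤ c := Real.rpow_nonneg (inv_nonneg.2 hNpos.le) _
        have hcp : c ^ p = N⁻¹ := by
          rw [hc, ← Real.rpow_mul (inv_nonneg.2 hNpos.le), one_div_mul_cancel (by linarith),
            Real.rpow_one]
        refine ⟨fun r => c * g r, continuous_const.mul hgc, fun r => mul_nonneg hc0 (hg0 r),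
          ?_, ?_⟩
        · have : ∫ r in (0:ℝ)..1, W r * tailI (fun r => c * g r) r ^ p =
              ∫ r in (0:ℝ)..1, N⁻¹ * (W r * tailI g r ^ p) := by
            apply intervalIntegral.integral_congr
            intro x hx
            rw [uIcc_of_le zero_le_one] at hx
            have : tailI (fun r => c * g r) x = c * tailI g x := by
              simp only [tailI, intervalIntegral.integral_const_mul]
            simp only [this]
            rw [Real.mul_rpow hc0 (tailI_nonneg g hg0 x hx.2), hcp]; ring
          rw [this, intervalIntegral.integral_const_mul, ← hN, inv_mul_cancel₀ hNpos.ne']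
        · have : ∫ r in (0:ℝ)..1, (c * g r) ^ p = N⁻¹ * ∫ r in (0:ℝ)..1, g r ^ p := by
            rw [← intervalIntegral.integral_const_mul]
            congr 1; funext r
            rw [Real.mul_rpow hc0 (hg0 r), hcp]
          rw [this, inv_mul_le_iff₀ hNpos, ← hqe]
          have f1 : q * ((p - 1) * ∫ r in (0:ℝ)..1, W r * |w r| ^ p) ≤ q * ((p - 1) * N) :=
            mul_le_mul_of_nonneg_left (mul_le_mul_of_nonneg_left e2 hp1.le) hq0
          have f2 : q * ((p - 1) * N) ≤ (eta1 a p + 1 / ((n:ℝ) + 1)) * ((p - 1) * N) :=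
            mul_le_mul_of_nonneg_right hq.le (by positivity)
          linarith
      obtain ⟨h, hhc, hh0, hhz, hheq, x0, hx0, hne0⟩ :=
        exist_core p hp W hW hW0 hWd (eta1 a p) hηpos hlow hmin
      set y := tailI h with hy
      have hyc : Continuous y := tailI_cont h hhc
      have hyn : ∀ r ∈ Icc (0:ℝ) 1, 0 ≤ y r := fun r hr => tailI_nonneg h hh0 r hr.2
      set k : ℝ → ℝ := fun t => eta1 a p * (p - 1) * W t * y t ^ (p - 1) with hk
      have hkc : Continuous k :=
        (continuous_const.mul hW).mul (hyc.rpow_const fun _ => Or.inr hp1.le)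
      have hkn : ∀ t ∈ Icc (0:ℝ) 1, 0 ≤ k t := fun t ht =>
        mul_nonneg (mul_nonneg (by positivity) (hW0 t)) (Real.rpow_nonneg (hyn t ht) _)
      refine ⟨y, fun r => -h r, ⟨hhc.neg.continuousOn,
        fun r _ => (tailI_deriv h hhc r).hasDerivWithinAt, ?_, by simp [hhz], tailI_one h⟩, ?_⟩
      · intro r hr
        have hr' : r ∈ Icc (0:ℝ) 1 := ⟨hr.1.le, hr.2.le⟩
        have h1 : HasDerivAt (fun r => -∫ t in (0:ℝ)..r, k t) (-k r) r :=
          (intervalIntegral.integral_hasDerivAt_right (hkc.intervalIntegrable _ _)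
            hkc.aestronglyMeasurable.stronglyMeasurableAtFilter hkc.continuousAt).neg
        have h2 : (fun t => |(-h t)| ^ (p - 2) * -h t) =ᶠ[𝓝 r]
            fun r => -∫ t in (0:ℝ)..r, k t := by
          filter_upwards [Icc_mem_nhds hr.1 hr.2] with t ht
          rw [← hheq t ht, abs_neg, abs_of_nonneg (hh0 t)]
          rcases (hh0 t).eq_or_lt with e | e
          · rw [← e, Real.zero_rpow hp1.ne']; ring
          · rw [show p - 1 = (p - 2) + 1 by ring, Real.rpow_add_one e.ne']; ring
        have h3 := h1.congr_of_eventuallyEq h2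
        refine HasDerivAt.congr_deriv h3 ?_
        simp only [hk]
        rw [hμη, hWe r hr']
        have : |y r| ^ (p - 2) * y r = y r ^ (p - 1) := by
          rw [abs_of_nonneg (hyn r hr')]
          rcases (hyn r hr').eq_or_lt with e | e
          · rw [← e, Real.zero_rpow hp1.ne']; ring
          · rw [show p - 1 = (p - 2) + 1 by ring, Real.rpow_add_one e.ne']
        rw [this]; ring
      · intro r hr
        have hr' : r ∈ Icc (0:ℝ) 1 := ⟨hr.1.le, hr.2.le⟩
        refine lt_of_le_of_ne (hyn r hr') fun hz => ?_
        -- h vanishes on [r,1]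
        have hz1 : ∀ t ∈ Icc r 1, h t = 0 := by
          intro t ht
          by_contra hne
          have : 0 < y r := intervalIntegral.integral_pos hr.2 hhc.continuousOn
            (fun x _ => hh0 x) ⟨t, ht, lt_of_le_of_ne (hh0 t) (Ne.symm hne)⟩
          linarith
        have hz2 : ∀ t ∈ Icc (0:ℝ) 1, h t = 0 := by
          intro t ht
          have g1 : h 1 ^ (p - 1) = 0 := by
            rw [hz1 1 ⟨hr.2.le, le_rfl⟩, Real.zero_rpow hp1.ne']
          rw [hheq 1 (by simp)] at g1
          have g2 : ∫ s in (0:ℝ)..t, k s ≤ ∫ s in (0:ℝ)..1, k s := by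
            rw [← intervalIntegral.integral_add_adjacent_intervals
              (hkc.intervalIntegrable 0 t) (hkc.intervalIntegrable t 1)]
            have := intervalIntegral.integral_nonneg (μ := MeasureTheory.volume) ht.2
              fun s hs => hkn s ⟨ht.1.trans hs.1, hs.2⟩
            linarith
          have g3 : h t ^ (p - 1) ≤ 0 := by
            rw [hheq t ht]; exact g2.trans g1.le
          have g4 := le_antisymm g3 (Real.rpow_nonneg (hh0 t) _)
          exact (Real.rpow_eq_zero (hh0 t) hp1.ne').1 g4
        apply hne0
        have : y x0 = ∫ t in x0..1, (0:ℝ) := by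
          apply intervalIntegral.integral_congr
          intro t ht
          rw [uIcc_of_le hx0.2] at ht
          exact hz2 t ⟨hx0.1.trans ht.1, ht.2⟩
        rw [this]; simp
end

section
/- The value μ₁(p) is an isolated eigenvalue: there exists δ_p > μ₁(p) such that for every μ ∈ (0, δ_p) with μ ≠ μ₁(p), problem (AP) has no nontrivial solution. -/
open Set Filter Topology intervalIntegral

/-- The odd power map. -/
noncomputable def phi (p t : ℝ) : ℝ := |t| ^ (p - 2) * t

lemma phi_cont {p : ℝ} (hp : 2 ≤ p) : Continuous (phi p) := by
  unfold phi
  exact (continuous_abs.rpow_const (fun x => Or.inr (by linarith))).mul continuous_id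

lemma phi_mul_self {p : ℝ} (hp : 2 ≤ p) (t : ℝ) : phi p t * t = |t| ^ p := by
  unfold phi
  rcases eq_or_ne t 0 with rfl | ht
  · simp [Real.zero_rpow (show p ≠ 0 by linarith)]
  · have h : 0 < |t| := abs_pos.mpr ht
    have : |t| ^ p = |t| ^ (p - 2) * |t| ^ (2:ℝ) := by
      rw [← Real.rpow_add h]; congr 1; ring
    rw [this, Real.rpow_two, sq_abs]; ring

lemma abs_phi {p : ℝ} (hp : 2 ≤ p) (t : ℝ) : |phi p t| = |t| ^ (p - 1) := by
  unfold phi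
  rw [abs_mul, abs_of_nonneg (Real.rpow_nonneg (abs_nonneg t) _)]
  rcases eq_or_ne t 0 with rfl | ht
  · simp [Real.zero_rpow (show p - 1 ≠ 0 by linarith)]
  · have h : 0 < |t| := abs_pos.mpr ht
    rw [← Real.rpow_add_one h.ne']; congr 1; ring

lemma phi_neg (p t : ℝ) : phi p (-t) = - phi p t := by
  unfold phi; rw [abs_neg]; ring

lemma phi_zero (p : ℝ) : phi p 0 = 0 := by simp [phi]

lemma phi_of_nonneg {p : ℝ} (hp : 2 ≤ p) {t : ℝ} (ht : 0 ≤ t) : phi p t = t ^ (p - 1) := by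
  have h := abs_phi hp t
  have h2 : 0 ≤ phi p t := by unfold phi; positivity
  rwa [abs_of_nonneg h2, abs_of_nonneg ht] at h

lemma phi_strictMono {p : ℝ} (hp : 2 ≤ p) : StrictMono (phi p) := by
  apply strictMono_of_odd_strictMonoOn_nonneg (phi_neg p)
  intro x hx y hy hxy
  rw [phi_of_nonneg hp hx, phi_of_nonneg hp hy]
  exact Real.rpow_lt_rpow hx hxy (by linarith)

lemma tangent {p : ℝ} (hp : 2 ≤ p) {X Y : ℝ} (hX : 0 ≤ X) (hY : 0 ≤ Y) :
    X ^ p + p * X ^ (p - 1) * (Y - X) ≤ Y ^ p := by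
  rcases hX.eq_or_lt with rfl | hX
  · rw [Real.zero_rpow (by linarith), Real.zero_rpow (by linarith)]
    simp; positivity
  · have h := one_add_mul_self_le_rpow_one_add (s := Y / X - 1)
      (by have : 0 ≤ Y / X := by positivity
          linarith) (p := p) (by linarith)
    have h2 : (1 + (Y / X - 1)) = Y / X := by ring
    rw [h2, Real.div_rpow hY hX.le, le_div_iff₀ (by positivity)] at h
    have h3 : X ^ p = X ^ (p - 1) * X := by
      rw [← Real.rpow_add_one hX.ne']; congr 1; ring
    refine le_trans (le_of_eq ?_) h
    rw [h3]; field_simp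

/-- Bundled solution data. -/
structure Sol (p L : ℝ) (h v v' : ℝ → ℝ) : Prop where
  hp : 2 ≤ p
  hL : 0 < L
  hc : ContinuousOn h (Icc 0 1)
  h0 : ∀ r ∈ Icc (0:ℝ) 1, 0 ≤ h r
  cv' : ContinuousOn v' (Icc 0 1)
  dv : ∀ r ∈ Icc (0:ℝ) 1, HasDerivWithinAt v (v' r) (Icc 0 1) r
  dphi : ∀ r ∈ Ioo (0:ℝ) 1, HasDerivAt (fun t => phi p (v' t)) (-(L * h r * phi p (v r))) r
  z0 : v' 0 = 0
  z1 : v 1 = 0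

lemma Sol.neg {p L : ℝ} {h v v' : ℝ → ℝ} (S : Sol p L h v v') :
    Sol p L h (fun r => - v r) (fun r => - v' r) where
  hp := S.hp
  hL := S.hL
  hc := S.hc
  h0 := S.h0
  cv' := S.cv'.neg
  dv := fun r hr => (S.dv r hr).neg
  dphi := fun r hr => by
    have := (S.dphi r hr).neg
    simp only [phi_neg]
    exact this.congr_deriv (by ring)
  z0 := by simp [S.z0]
  z1 := by simp [S.z1]

lemma cont_of_dv {v v' : ℝ → ℝ} (dv : ∀ r ∈ Icc (0:ℝ) 1, HasDerivWithinAt v (v' r) (Icc 0 1) r) :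
    ContinuousOn v (Icc 0 1) := fun r hr => (dv r hr).continuousWithinAt

lemma deriv_of_dv {v v' : ℝ → ℝ} (dv : ∀ r ∈ Icc (0:ℝ) 1, HasDerivWithinAt v (v' r) (Icc 0 1) r)
    {r : ℝ} (hr : r ∈ Ioo (0:ℝ) 1) : HasDerivAt v (v' r) r :=
  (dv r ⟨hr.1.le, hr.2.le⟩).hasDerivAt (Icc_mem_nhds hr.1 hr.2)

lemma Sol.cv {p L : ℝ} {h v v' : ℝ → ℝ} (S : Sol p L h v v') : ContinuousOn v (Icc 0 1) :=
  cont_of_dv S.dv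

lemma Sol.cphi {p L : ℝ} {h v v' : ℝ → ℝ} (S : Sol p L h v v') :
    ContinuousOn (fun t => phi p (v' t)) (Icc 0 1) :=
  (phi_cont S.hp).comp_continuousOn S.cv'

lemma Sol.cphiv {p L : ℝ} {h v v' : ℝ → ℝ} (S : Sol p L h v v') :
    ContinuousOn (fun t => phi p (v t)) (Icc 0 1) :=
  (phi_cont S.hp).comp_continuousOn S.cv

lemma mvt_bound {f f' : ℝ → ℝ} {s t C : ℝ} (hC : 0 ≤ C) (hf : ContinuousOn f (Icc s t))
    (hd : ∀ x ∈ Ioo s t, HasDerivAt f (f' x) x) (hb : ∀ x ∈ Ioo s t, |f' x| ≤ C)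
    {x y : ℝ} (hx : x ∈ Icc s t) (hy : y ∈ Icc s t) : |f x - f y| ≤ C * |x - y| := by
  wlog hxy : x < y generalizing x y
  · rcases eq_or_lt_of_le (not_lt.mp hxy) with e | e
    · subst e; simp
    · rw [abs_sub_comm (f x), abs_sub_comm x]; exact this hy hx e
  have sub : Ioo x y ⊆ Ioo s t := Ioo_subset_Ioo hx.1 hy.2
  obtain ⟨c, hc, e⟩ := exists_hasDerivAt_eq_slope f f' hxy (hf.mono (Icc_subset_Icc hx.1 hy.2))
    (fun z hz => hd z (sub hz))
  have h1 : f y - f x = f' c * (y - x) := by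
    rw [e, div_mul_cancel₀]; linarith
  rw [abs_sub_comm (f x), abs_sub_comm x, h1, abs_mul]
  exact mul_le_mul_of_nonneg_right (hb c (sub hc)) (abs_nonneg _)

lemma Sol.small {p L : ℝ} {h v v' : ℝ → ℝ} (S : Sol p L h v v') {A : ℝ}
    (hA : ∀ r ∈ Icc (0:ℝ) 1, h r ≤ A) {s t c d x : ℝ} (hs : 0 ≤ s) (ht : t ≤ 1) (hst : s < t)
    (hcm : c ∈ Icc s t) (hdm : d ∈ Icc s t) (hx : x ∈ Icc s t) (hc0 : v' c = 0) (hd0 : v d = 0)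
    (hmax : ∀ r ∈ Icc s t, |v r| ≤ |v x|) (hne : v x ≠ 0) : 1 ≤ L * A * (t - s) := by
  have hp := S.hp
  have hL := S.hL
  have hA0 : 0 ≤ A := (S.h0 0 (by simp)).trans (hA 0 (by simp))
  have sub : Icc s t ⊆ Icc 0 1 := Icc_subset_Icc hs ht
  have subo : Ioo s t ⊆ Ioo 0 1 := Ioo_subset_Ioo hs ht
  have ed : ∀ {x y : ℝ}, x ∈ Icc s t → y ∈ Icc s t → |x - y| ≤ t - s := fun hx hy => by
    rw [abs_le]; constructor <;> linarith [hx.1, hx.2, hy.1, hy.2]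
  set M := |v x| with hM
  have hMp : 0 < M := abs_pos.mpr hne
  have hMq : 0 < M ^ (p - 1) := by positivity
  have hl : 0 < t - s := by linarith
  have h1 : ∀ r ∈ Icc s t, |v' r| ^ (p - 1) ≤ L * A * M ^ (p - 1) * (t - s) := by
    intro r hr
    have := mvt_bound (C := L * A * M ^ (p - 1)) (by positivity) (S.cphi.mono sub)
      (fun x hx => S.dphi x (subo hx)) (fun y hy => by
        have hy1 := sub (Ioo_subset_Icc_self hy)
        rw [abs_neg, abs_mul, abs_mul, abs_of_pos hL, abs_of_nonneg (S.h0 y hy1), abs_phi hp]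
        have := Real.rpow_le_rpow (abs_nonneg _) (hmax y (Ioo_subset_Icc_self hy))
          (show 0 ≤ p - 1 by linarith)
        have h3 := hA y hy1
        have h4 := S.h0 y hy1
        gcongr) hr hcm
    rw [hc0, phi_zero, sub_zero, abs_phi hp] at this
    exact this.trans (mul_le_mul_of_nonneg_left (ed hr hcm) (by positivity))
  set B := L * A * (t - s) with hB
  have hB0 : 0 ≤ B := by positivity
  have h2 : ∀ r ∈ Icc s t, |v' r| ≤ B ^ (1 / (p - 1)) * M := by
    intro r hr
    have e : (|v' r| ^ (p - 1)) ^ (1 / (p - 1)) = |v' r| := by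
      rw [← Real.rpow_mul (abs_nonneg _), mul_one_div_cancel (by linarith), Real.rpow_one]
    have e2 : (B * M ^ (p - 1)) ^ (1 / (p - 1)) = B ^ (1 / (p - 1)) * M := by
      rw [Real.mul_rpow hB0 hMq.le, ← Real.rpow_mul hMp.le, mul_one_div_cancel (by linarith),
        Real.rpow_one]
    rw [← e, ← e2]
    apply Real.rpow_le_rpow (by positivity) _ (by have : 0 < p - 1 := by linarith
                                                  positivity)
    refine (h1 r hr).trans (le_of_eq ?_)
    rw [hB]; ring
  have h3 := mvt_bound (C := B ^ (1 / (p - 1)) * M) (by positivity) (S.cv.mono sub)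
      (fun x hx => deriv_of_dv S.dv (subo hx)) (fun y hy => h2 y (Ioo_subset_Icc_self hy)) hx hdm
  rw [hd0, sub_zero] at h3
  have h4 : M ≤ B ^ (1 / (p - 1)) * M := by
    refine h3.trans (mul_le_of_le_one_right (by positivity) ((ed hx hdm).trans (by linarith)))
  have h5 : 1 ≤ B ^ (1 / (p - 1)) := by
    by_contra hcon
    push Not at hcon
    nlinarith
  by_contra hcon
  push Not at hcon
  have : B ^ (1 / (p - 1)) < 1 := Real.rpow_lt_one hB0 hcon (by
    have : 0 < p - 1 := by linarith
    positivity)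
  linarith

lemma Sol.uniq {p L : ℝ} {h v v' : ℝ → ℝ} (S : Sol p L h v v') {A : ℝ}
    (hA : ∀ r ∈ Icc (0:ℝ) 1, h r ≤ A) (hv : v 0 = 0) : ∀ r ∈ Icc (0:ℝ) 1, v r = 0 := by
  have hL := S.hL
  have hA0 : 0 ≤ A := (S.h0 0 (by simp)).trans (hA 0 (by simp))
  have key : Icc (0:ℝ) 1 ⊆ {x | v x = 0 ∧ v' x = 0} := by
    apply IsClosed.Icc_subset_of_forall_mem_nhdsWithin
    · have h1 := S.cv.preimage_isClosed_of_isClosed isClosed_Icc (isClosed_singleton (x := (0:ℝ)))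
      have h2 := S.cv'.preimage_isClosed_of_isClosed isClosed_Icc (isClosed_singleton (x := (0:ℝ)))
      convert h1.inter h2 using 1
      ext x
      simp only [mem_inter_iff, mem_ofPred_eq, mem_preimage, mem_singleton_iff]
      tauto
    · exact ⟨hv, S.z0⟩
    · rintro x ⟨⟨hx0, hx1⟩, hx⟩
      set ε := 1 / (L * A + 1) with hε
      have hεp : 0 < ε := by positivity
      set t := min (x + ε) 1 with ht
      have hxt : x < t := lt_min (by linarith) hx.2
      have ht1 : t ≤ 1 := min_le_right _ _
      have sub : Icc x t ⊆ Icc 0 1 := Icc_subset_Icc hx.1 ht1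
      obtain ⟨y, hy, hmax⟩ := isCompact_Icc.exists_isMaxOn (nonempty_Icc.mpr hxt.le)
        ((S.cv.mono sub).abs)
      have hy0 : v y = 0 := by
        by_contra hne
        have := S.small hA hx.1 ht1 hxt (left_mem_Icc.mpr hxt.le) (left_mem_Icc.mpr hxt.le) hy
          hx1 hx0 (fun r hr => hmax hr) hne
        have h2 : t - x ≤ ε := by linarith [min_le_left (x + ε) 1]
        have h3 : L * A * (t - x) ≤ L * A * ε := mul_le_mul_of_nonneg_left h2 (by positivity)
        have h4 : L * A * ε < 1 := by
          rw [hε, mul_one_div, div_lt_one (by positivity)]; linarith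
        linarith
      have hz : ∀ r ∈ Icc x t, v r = 0 := fun r hr => by
        have : |v r| ≤ |v y| := hmax hr
        rw [hy0, abs_zero] at this
        exact abs_nonpos_iff.mp this
      filter_upwards [Ioo_mem_nhdsGT hxt] with r hr
      refine ⟨hz r (Ioo_subset_Icc_self hr), ?_⟩
      have d1 := deriv_of_dv S.dv (Ioo_subset_Ioo hx.1 ht1 hr)
      have d2 : HasDerivAt v 0 r := (hasDerivAt_const r (0:ℝ)).congr_of_eventuallyEq (by
        filter_upwards [Ioo_mem_nhds hr.1 hr.2] with q hq using hz q (Ioo_subset_Icc_self hq))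
      exact d1.unique d2
  exact fun r hr => (key hr).1

lemma Sol.first_zero {p L : ℝ} {h v v' : ℝ → ℝ} (S : Sol p L h v v') (hv : 0 < v 0) :
    ∃ z, 0 < z ∧ z ≤ 1 ∧ v z = 0 ∧ ∀ r, 0 ≤ r → r < z → 0 < v r := by
  have hcl : IsClosed (Icc (0:ℝ) 1 ∩ v ⁻¹' {0}) :=
    S.cv.preimage_isClosed_of_isClosed isClosed_Icc (isClosed_singleton (x := (0:ℝ)))
  have hK : IsCompact (Icc (0:ℝ) 1 ∩ v ⁻¹' {0}) :=
    isCompact_Icc.of_isClosed_subset hcl inter_subset_left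
  obtain ⟨z, ⟨hz, hz0⟩, hmin⟩ := hK.exists_isLeast ⟨1, by simp, S.z1⟩
  have hz0 : v z = 0 := hz0
  have hzp : 0 < z := by
    rcases hz.1.eq_or_lt with e | e
    · subst e; linarith
    · exact e
  refine ⟨z, hzp, hz.2, hz0, ?_⟩
  intro r hr0 hrz
  by_contra hneg
  push Not at hneg
  have := intermediate_value_Icc' hr0 (S.cv.mono (Icc_subset_Icc le_rfl (hrz.le.trans hz.2)))
  obtain ⟨y, hy, hy0⟩ := this ⟨hneg, hv.le⟩
  have := hmin ⟨⟨hy.1, hy.2.trans (hrz.le.trans hz.2)⟩, hy0⟩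
  linarith [hy.2]

lemma Sol.anti {p L : ℝ} {h v v' : ℝ → ℝ} (S : Sol p L h v v') {z : ℝ} (hz : 0 < z) (hz1 : z ≤ 1)
    (hpos : ∀ r, 0 ≤ r → r < z → 0 < v r) : AntitoneOn v' (Icc 0 z) := by
  have key : AntitoneOn (fun t => phi p (v' t)) (Icc 0 z) := by
    apply antitoneOn_of_hasDerivWithinAt_nonpos (convex_Icc 0 z)
      (S.cphi.mono (Icc_subset_Icc le_rfl hz1))
      (f' := fun r => -(L * h r * phi p (v r)))
    · intro r hr
      rw [interior_Icc] at hr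
      exact (S.dphi r ⟨hr.1, hr.2.trans_le hz1⟩).hasDerivWithinAt
    · intro r hr
      rw [interior_Icc] at hr
      have h1 := S.h0 r ⟨hr.1.le, (hr.2.trans_le hz1).le⟩
      have h2 := hpos r hr.1.le hr.2
      have hL := S.hL
      rw [phi_of_nonneg S.hp h2.le]
      have : 0 ≤ L * h r * v r ^ (p - 1) := by positivity
      linarith
  intro x hx y hy hxy
  exact (phi_strictMono S.hp).le_iff_le.mp (key hx hy hxy)

lemma abs_rpow_cont {u : ℝ → ℝ} {p : ℝ} {s : Set ℝ} (hp : 2 ≤ p) (hu : ContinuousOn u s) :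
    ContinuousOn (fun r => |u r| ^ p) s :=
  hu.abs.rpow_const (fun _ _ => Or.inr (by linarith))

lemma ii_of_cont {f : ℝ → ℝ} {s t : ℝ} (hs : 0 ≤ s) (hst : s ≤ t) (ht : t ≤ 1)
    (hf : ContinuousOn f (Icc 0 1)) : IntervalIntegrable f MeasureTheory.volume s t := by
  apply ContinuousOn.intervalIntegrable
  rw [uIcc_of_le hst]
  exact hf.mono (Icc_subset_Icc hs ht)

lemma Sol.energy {p L : ℝ} {h v v' : ℝ → ℝ} (S : Sol p L h v v') {z : ℝ} (hz : 0 < z) (hz1 : z ≤ 1)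
    (hvz : v z = 0) :
    ∫ r in (0:ℝ)..z, |v' r| ^ p = L * ∫ r in (0:ℝ)..z, h r * |v r| ^ p := by
  have hp := S.hp
  have c1 : ContinuousOn (fun r => |v' r| ^ p) (Icc 0 1) := abs_rpow_cont hp S.cv'
  have c2 : ContinuousOn (fun r => h r * |v r| ^ p) (Icc 0 1) := S.hc.mul (abs_rpow_cont hp S.cv)
  have i1 := ii_of_cont le_rfl hz.le hz1 c1
  have i2 := ii_of_cont le_rfl hz.le hz1 c2
  have key := intervalIntegral.integral_eq_sub_of_hasDerivAt_of_le hz.le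
    (f := fun r => phi p (v' r) * v r) (f' := fun r => |v' r| ^ p - L * (h r * |v r| ^ p))
    ((S.cphi.mul S.cv).mono (Icc_subset_Icc le_rfl hz1))
    (fun x hx => by
      have hx1 : x ∈ Ioo (0:ℝ) 1 := ⟨hx.1, hx.2.trans_le hz1⟩
      refine ((S.dphi x hx1).mul (deriv_of_dv S.dv hx1)).congr_deriv ?_
      rw [← phi_mul_self hp, ← phi_mul_self hp]; ring)
    (i1.sub (i2.const_mul L))
  rw [intervalIntegral.integral_sub i1 (i2.const_mul L), intervalIntegral.integral_const_mul] at key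
  simp only [hvz, S.z0, phi_zero, mul_zero, zero_mul, sub_zero] at key
  linarith

lemma Sol.flux {p L : ℝ} {h v v' : ℝ → ℝ} (S : Sol p L h v v') {z : ℝ} (hz : 0 < z) (hz1 : z ≤ 1) :
    - phi p (v' z) = L * ∫ r in (0:ℝ)..z, h r * phi p (v r) := by
  have c2 : ContinuousOn (fun r => h r * phi p (v r)) (Icc 0 1) := S.hc.mul S.cphiv
  have i2 := ii_of_cont le_rfl hz.le hz1 c2
  have key := intervalIntegral.integral_eq_sub_of_hasDerivAt_of_le hz.le
    (f := fun r => phi p (v' r)) (f' := fun r => (-L) * (h r * phi p (v r)))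
    (S.cphi.mono (Icc_subset_Icc le_rfl hz1))
    (fun x hx => by
      have hx1 : x ∈ Ioo (0:ℝ) 1 := ⟨hx.1, hx.2.trans_le hz1⟩
      exact (S.dphi x hx1).congr_deriv (by ring))
    (i2.const_mul (-L))
  rw [intervalIntegral.integral_const_mul] at key
  simp only [S.z0, phi_zero, sub_zero] at key
  linarith

lemma picone_alg {p : ℝ} (hp : 2 ≤ p) {u u' v v' : ℝ} (hv : 0 < v) :
    p * phi p u * u' * phi p v' * v ^ (1 - p) + |u| ^ p * (phi p v' * v' * (1 - p) * v ^ (-p))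
      ≤ |u'| ^ p := by
  have hX : 0 ≤ |u| * |v'| / v := by positivity
  have h := tangent hp hX (abs_nonneg u')
  have e1 : (|u| * |v'| / v) ^ p = |u| ^ p * |v'| ^ p * v ^ (-p) := by
    rw [Real.div_rpow (by positivity) hv.le, Real.mul_rpow (abs_nonneg _) (abs_nonneg _),
      Real.rpow_neg hv.le]; rfl
  have e2 : (|u| * |v'| / v) ^ (p - 1) = |phi p u| * |phi p v'| * v ^ (1 - p) := by
    rw [Real.div_rpow (by positivity) hv.le, Real.mul_rpow (abs_nonneg _) (abs_nonneg _),
      abs_phi hp, abs_phi hp, show (1 - p) = -(p - 1) by ring, Real.rpow_neg hv.le]; rfl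
  have e3 : (|u| * |v'| / v) ^ (p - 1) * (|u| * |v'| / v) = (|u| * |v'| / v) ^ p := by
    rcases hX.eq_or_lt with e | e
    · rw [← e, Real.zero_rpow (by linarith), Real.zero_rpow (by linarith)]; simp
    · rw [← Real.rpow_add_one e.ne']; congr 1; ring
  rw [phi_mul_self hp]
  have h2 : phi p u * u' * phi p v' * v ^ (1 - p) ≤ (|u| * |v'| / v) ^ (p - 1) * |u'| := by
    rw [e2]
    have : 0 < v ^ (1 - p) := by positivity
    have h3 : phi p u * u' * phi p v' ≤ |phi p u| * |phi p v'| * |u'| := by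
      refine (le_abs_self _).trans (le_of_eq ?_)
      rw [abs_mul, abs_mul]; ring
    nlinarith
  have h4 : p * (phi p u * u' * phi p v' * v ^ (1 - p)) ≤
      p * ((|u| * |v'| / v) ^ (p - 1) * |u'|) := mul_le_mul_of_nonneg_left h2 (by linarith)
  have h5 : |u| ^ p * (|v'| ^ p * (1 - p) * v ^ (-p)) = (1 - p) * (|u| * |v'| / v) ^ p := by
    rw [e1]; ring
  rw [h5]
  have h6 : p * (|u| * |v'| / v) ^ (p - 1) * (|u'| - |u| * |v'| / v) =
    p * ((|u| * |v'| / v) ^ (p - 1) * |u'|) - p * (|u| * |v'| / v) ^ p := by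
    rw [← e3]; ring
  rw [h6] at h
  linarith

lemma Sol.picone {p L : ℝ} {h v v' : ℝ → ℝ} (S : Sol p L h v v')
    (hpos : ∀ r, 0 ≤ r → r < 1 → 0 < v r) {u u' : ℝ → ℝ} (cu' : ContinuousOn u' (Icc 0 1))
    (du : ∀ r ∈ Icc (0:ℝ) 1, HasDerivWithinAt u (u' r) (Icc 0 1) r) (hu1 : u 1 = 0) :
    L * ∫ r in (0:ℝ)..1, h r * |u r| ^ p ≤ ∫ r in (0:ℝ)..1, |u' r| ^ p := by
  have hp := S.hp
  have cu := cont_of_dv du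
  have c1 : ContinuousOn (fun r => |u' r| ^ p) (Icc 0 1) := abs_rpow_cont hp cu'
  have c2 : ContinuousOn (fun r => h r * |u r| ^ p) (Icc 0 1) := S.hc.mul (abs_rpow_cont hp cu)
  have i1 := ii_of_cont le_rfl zero_le_one le_rfl c1
  have i2 := ii_of_cont le_rfl zero_le_one le_rfl c2
  set G : ℝ → ℝ := fun x => |u x| ^ p * (phi p (v' x) * v x ^ (1 - p)) with hG
  have hG1 : G 1 = 0 := by simp [hG, hu1, Real.zero_rpow (show p ≠ 0 by linarith)]
  have hG0 : G 0 = 0 := by simp [hG, S.z0, phi_zero]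
  -- lower bound for v
  have hlow : ∀ x ∈ Ico (0:ℝ) 1, v 0 * (1 - x) ≤ v x := by
    have hanti := S.anti zero_lt_one le_rfl hpos
    have hconc : ConcaveOn ℝ (Icc 0 1) v := by
      apply AntitoneOn.concaveOn_of_deriv (convex_Icc 0 1) S.cv
      · rw [interior_Icc]
        exact fun x hx => (deriv_of_dv S.dv hx).differentiableAt.differentiableWithinAt
      · rw [interior_Icc]
        intro x hx y hy hxy
        rw [(deriv_of_dv S.dv hx).deriv, (deriv_of_dv S.dv hy).deriv]
        exact hanti (Ioo_subset_Icc_self hx) (Ioo_subset_Icc_self hy) hxy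
    intro x hx
    have := hconc.2 (show (0:ℝ) ∈ Icc (0:ℝ) 1 by simp) (show (1:ℝ) ∈ Icc (0:ℝ) 1 by simp)
      (show 0 ≤ 1 - x by linarith [hx.2]) hx.1 (by ring)
    simp only [smul_eq_mul, S.z1, mul_zero, add_zero, mul_one, zero_add] at this
    linarith
  obtain ⟨C, hC⟩ := isCompact_Icc.exists_bound_of_continuousOn cu'
  obtain ⟨B, hB⟩ := isCompact_Icc.exists_bound_of_continuousOn S.cphi
  have hC0 : 0 ≤ C := (norm_nonneg _).trans (hC 0 (by simp))
  have hB0 : 0 ≤ B := (norm_nonneg _).trans (hB 0 (by simp))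
  have hv0 : 0 < v 0 := hpos 0 le_rfl zero_lt_one
  have hbd : ∀ x ∈ Icc (0:ℝ) 1, |G x| ≤ C ^ p * B * v 0 ^ (1 - p) * (1 - x) := by
    intro x hx
    rcases hx.2.eq_or_lt with rfl | hx1
    · simp [hG1]
    have hx1' : 0 < 1 - x := by linarith
    have b1 : |u x| ≤ C * (1 - x) := by
      have := mvt_bound hC0 cu (fun y hy => deriv_of_dv du hy)
        (fun y hy => hC y (Ioo_subset_Icc_self hy)) hx (show (1:ℝ) ∈ Icc (0:ℝ) 1 by simp)
      rwa [hu1, sub_zero, abs_sub_comm, abs_of_pos hx1'] at this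
    have b2 : |u x| ^ p ≤ (C * (1 - x)) ^ p :=
      Real.rpow_le_rpow (abs_nonneg _) b1 (by linarith)
    have b3 : v x ^ (1 - p) ≤ (v 0 * (1 - x)) ^ (1 - p) :=
      Real.rpow_le_rpow_of_nonpos (by positivity) (hlow x ⟨hx.1, hx1⟩) (by linarith)
    have b4 : |phi p (v' x)| ≤ B := hB x hx
    have hvx := hpos x hx.1 hx1
    rw [hG]
    simp only
    rw [abs_mul, abs_mul, abs_of_nonneg (by positivity : 0 ≤ |u x| ^ p),
      abs_of_nonneg (by positivity : 0 ≤ v x ^ (1 - p))]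
    calc |u x| ^ p * (|phi p (v' x)| * v x ^ (1 - p))
        ≤ (C * (1 - x)) ^ p * (B * (v 0 * (1 - x)) ^ (1 - p)) := by gcongr
      _ = C ^ p * B * v 0 ^ (1 - p) * ((1 - x) ^ p * (1 - x) ^ (1 - p)) := by
          rw [Real.mul_rpow hC0 hx1'.le, Real.mul_rpow hv0.le hx1'.le]; ring
      _ = _ := by
          rw [← Real.rpow_add hx1']; simp
  have cG : ContinuousOn G (Icc 0 1) := by
    intro x hx
    rcases hx.2.eq_or_lt with rfl | hx1
    · have : Tendsto G (𝓝[Icc 0 1] 1) (𝓝 0) := by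
        apply squeeze_zero_norm' (a := fun x => C ^ p * B * v 0 ^ (1 - p) * (1 - x))
        · filter_upwards [self_mem_nhdsWithin] with x hx using hbd x hx
        · have : Continuous (fun x => C ^ p * B * v 0 ^ (1 - p) * (1 - x)) := by fun_prop
          have := (this.tendsto 1).mono_left (nhdsWithin_le_nhds (s := Icc (0:ℝ) 1))
          simpa using this
      unfold ContinuousWithinAt
      rwa [hG1]
    · exact ((abs_rpow_cont hp cu) x hx).mul ((S.cphi x hx).mul
        ((S.cv x hx).rpow_const (Or.inl (hpos x hx.1 hx1).ne')))
  have key := intervalIntegral.sub_le_integral_of_hasDeriv_right_of_le zero_le_one cG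
    (g' := fun x => (p * phi p (u x) * u' x) * (phi p (v' x) * v x ^ (1 - p)) +
      |u x| ^ p * (-(L * h x * phi p (v x)) * v x ^ (1 - p) +
        phi p (v' x) * (v' x * (1 - p) * v x ^ (1 - p - 1))))
    (φ := fun r => |u' r| ^ p - L * (h r * |u r| ^ p))
    (fun x hx => by
      have hvx := hpos x hx.1.le hx.2
      have d1 : HasDerivAt (fun x => |u x| ^ p) (p * phi p (u x) * u' x) x := by
        have := (hasDerivAt_abs_rpow (u x) (show 1 < p by linarith)).comp x (deriv_of_dv du hx)
        refine this.congr_deriv ?_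
        unfold phi; ring
      have d2 := (deriv_of_dv S.dv hx).rpow_const (p := 1 - p) (Or.inl hvx.ne')
      exact (d1.mul ((S.dphi x hx).mul d2)).hasDerivWithinAt)
    ((c1.sub (continuousOn_const.mul c2)).integrableOn_Icc)
    (fun x hx => by
      have hvx := hpos x hx.1.le hx.2
      have h1 := picone_alg hp (u := u x) (u' := u' x) (v' := v' x) hvx
      have h2 : phi p (v x) * v x ^ (1 - p) = 1 := by
        rw [phi_of_nonneg hp hvx.le, ← Real.rpow_add hvx]; simp
      have h3 : 1 - p - 1 = -p := by ring
      rw [h3]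
      have h4 : |u x| ^ p * (-(L * h x * phi p (v x)) * v x ^ (1 - p)) =
        - (L * (h x * |u x| ^ p)) := by
        linear_combination (-(L * h x * |u x| ^ p)) * h2
      linarith)
  rw [hG1, hG0, intervalIntegral.integral_sub i1 (i2.const_mul L),
    intervalIntegral.integral_const_mul] at key
  linarith

lemma Sol.slope_pos {p L : ℝ} {h v v' : ℝ → ℝ} (S : Sol p L h v v') {z : ℝ} (hz : 0 < z)
    (hz1 : z ≤ 1) (hvz : v z = 0) (hpos : ∀ r, 0 ≤ r → r < z → 0 < v r) : v' z < 0 := by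
  have hanti := S.anti hz hz1 hpos
  have h0 : v' z ≤ 0 := by
    have := hanti (left_mem_Icc.mpr hz.le) (right_mem_Icc.mpr hz.le) hz.le
    rwa [S.z0] at this
  rcases h0.eq_or_lt with e | e
  · exfalso
    have := mvt_bound (C := 0) le_rfl (S.cv.mono (Icc_subset_Icc le_rfl hz1))
      (fun x hx => deriv_of_dv S.dv ⟨hx.1, hx.2.trans_le hz1⟩)
      (fun x hx => by
        have h1 := hanti (left_mem_Icc.mpr hz.le) (Ioo_subset_Icc_self hx) hx.1.le
        have h2 := hanti (Ioo_subset_Icc_self hx) (right_mem_Icc.mpr hz.le) hx.2.le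
        rw [S.z0] at h1
        rw [e] at h2
        rw [le_antisymm h1 h2, abs_zero])
      (left_mem_Icc.mpr hz.le) (right_mem_Icc.mpr hz.le)
    rw [hvz, sub_zero, zero_mul] at this
    have h3 := hpos 0 le_rfl hz
    have h4 := abs_nonpos_iff.mp this
    linarith
  · exact e

lemma Sol.tail {p L : ℝ} {h v v' : ℝ → ℝ} (S : Sol p L h v v') {A : ℝ}
    (hA : ∀ r ∈ Icc (0:ℝ) 1, h r ≤ A) {z : ℝ} (hz : 0 < z) (hz1 : z < 1) (hvz : v z = 0)
    (hne : v' z ≠ 0) : 1 ≤ L * A * (1 - z) := by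
  have sub : Icc z 1 ⊆ Icc (0:ℝ) 1 := Icc_subset_Icc hz.le le_rfl
  obtain ⟨y, hy, hmax⟩ := isCompact_Icc.exists_isMaxOn (nonempty_Icc.mpr hz1.le)
        ((S.cv.mono sub).abs)
  have hmax' : ∀ r ∈ Icc z 1, |v r| ≤ |v y| := fun r hr => hmax hr
  have hy0 : v y ≠ 0 := by
    intro h0
    have hzero : ∀ r ∈ Icc z 1, v r = 0 := fun r hr => by
      have := hmax' r hr
      rw [h0, abs_zero] at this
      exact abs_nonpos_iff.mp this
    have d1 : HasDerivWithinAt v (v' z) (Icc z 1) z := (S.dv z ⟨hz.le, hz1.le⟩).mono sub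
    have d2 : HasDerivWithinAt v 0 (Icc z 1) z :=
      (hasDerivWithinAt_const z (Icc z 1) (0:ℝ)).congr hzero hvz
    exact hne ((uniqueDiffOn_Icc hz1 z (left_mem_Icc.mpr hz1.le)).eq_deriv _ d1 d2)
  have hy1 : z < y := lt_of_le_of_ne hy.1 (fun e => hy0 (e ▸ hvz))
  have hy2 : y < 1 := lt_of_le_of_ne hy.2 (fun e => hy0 (e ▸ S.z1))
  have dy := deriv_of_dv S.dv (r := y) ⟨hz.trans hy1, hy2⟩
  have hd : v' y = 0 := by
    rcases lt_or_gt_of_ne hy0 with hn | hn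
    · have : IsLocalMin v y := by
        filter_upwards [Icc_mem_nhds hy1 hy2] with r hr
        have := hmax' r hr
        rw [abs_of_neg hn] at this
        linarith [neg_abs_le (v r)]
      exact this.hasDerivAt_eq_zero dy
    · have : IsLocalMax v y := by
        filter_upwards [Icc_mem_nhds hy1 hy2] with r hr
        have := hmax' r hr
        rw [abs_of_pos hn] at this
        linarith [le_abs_self (v r)]
      exact this.hasDerivAt_eq_zero dy
  exact S.small hA hz.le le_rfl hz1 hy (left_mem_Icc.mpr hz1.le) hy hd hvz hmax' hy0

lemma Sol.gap {p L : ℝ} {h v v' : ℝ → ℝ} (S : Sol p L h v v') {A E1 : ℝ} (hA0 : 0 < A)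
    (hE1 : 0 ≤ E1) (hA : ∀ r ∈ Icc (0:ℝ) 1, h r ≤ A)
    (hE : ∀ u u' : ℝ → ℝ, ContinuousOn u' (Icc 0 1) →
      (∀ r ∈ Icc (0:ℝ) 1, HasDerivWithinAt u (u' r) (Icc 0 1) r) → u' 0 = 0 → u 1 = 0 →
      (∃ r ∈ Icc (0:ℝ) 1, u r ≠ 0) →
      E1 * ∫ r in (0:ℝ)..1, h r * |u r| ^ p ≤ ∫ r in (0:ℝ)..1, |u' r| ^ p)
    {z : ℝ} (hz : 0 < z) (hz1 : z < 1) (hvz : v z = 0)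
    (hpos : ∀ r, 0 ≤ r → r < z → 0 < v r) : E1 + 1 / (4 * A) ≤ L := by
  have hp := S.hp
  have hL := S.hL
  have hsl := S.slope_pos hz hz1.le hvz hpos
  have htail := S.tail hA hz hz1 hvz hsl.ne
  have hanti := S.anti hz hz1.le hpos
  have hen := S.energy hz hz1.le hvz
  have hfl := S.flux hz hz1.le
  obtain ⟨m, hm⟩ : ∃ m, m = - v' z := ⟨_, rfl⟩
  have hmp : 0 < m := by linarith
  have hvm : v' z = - m := by linarith
  obtain ⟨τ, hτ⟩ : ∃ τ, τ = 1 - z := ⟨_, rfl⟩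
  have hτp : 0 < τ := by linarith
  rw [← hτ] at htail
  rw [hvm, phi_neg, neg_neg, phi_of_nonneg hp hmp.le] at hfl
  set u : ℝ → ℝ := fun r => v (min r z) + m / (2 * τ) * (1 - max r z) ^ 2 with hu
  set u' : ℝ → ℝ := fun r => v' (min r z) + m - m / τ * (1 - max r z) with hu'
  have ul : ∀ r, r ≤ z → u r = v r + m * τ / 2 := fun r hr => by
    simp only [hu, min_eq_left hr, max_eq_right hr, ← hτ]
    field_simp
  have ur : ∀ r, z ≤ r → u r = m / (2 * τ) * (1 - r) ^ 2 := fun r hr => by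
    simp only [hu, min_eq_right hr, max_eq_left hr, hvz, zero_add]
  have ul' : ∀ r, r ≤ z → u' r = v' r := fun r hr => by
    simp only [hu', min_eq_left hr, max_eq_right hr, ← hτ]
    field_simp
    ring
  have ur' : ∀ r, z ≤ r → u' r = - (m / τ * (1 - r)) := fun r hr => by
    simp only [hu', min_eq_right hr, max_eq_left hr, hvm]
    ring
  have cu' : ContinuousOn u' (Icc 0 1) := by
    have c1 : ContinuousOn (fun r => v' (min r z)) (Icc 0 1) :=
      S.cv'.comp (by fun_prop) (fun r hr => ⟨le_min hr.1 hz.le, (min_le_left _ _).trans hr.2⟩)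
    exact (c1.add continuousOn_const).sub (by fun_prop)
  have dl : ∀ r ∈ Icc (0:ℝ) z, HasDerivWithinAt u (u' r) (Icc 0 z) r := by
    intro r hr
    rw [ul' r hr.2]
    have := ((S.dv r ⟨hr.1, hr.2.trans hz1.le⟩).mono
      (Icc_subset_Icc le_rfl hz1.le)).add_const (m * τ / 2)
    exact this.congr (fun x hx => ul x hx.2) (ul r hr.2)
  have dr : ∀ r ∈ Icc z 1, HasDerivWithinAt u (u' r) (Icc z 1) r := by
    intro r hr
    rw [ur' r hr.1]
    have : HasDerivAt (fun r : ℝ => m / (2 * τ) * (1 - r) ^ 2) (- (m / τ * (1 - r))) r := by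
      have := ((((hasDerivAt_id r).const_sub 1).pow 2).const_mul (m / (2 * τ)))
      refine this.congr_deriv ?_
      simp
      field_simp
    exact this.hasDerivWithinAt.congr (fun x hx => ur x hx.1) (ur r hr.1)
  have du : ∀ r ∈ Icc (0:ℝ) 1, HasDerivWithinAt u (u' r) (Icc 0 1) r := by
    intro r hr
    rcases lt_trichotomy r z with h1 | h1 | h1
    · apply (dl r ⟨hr.1, h1.le⟩).mono_of_mem_nhdsWithin
      filter_upwards [self_mem_nhdsWithin, nhdsWithin_le_nhds (Iio_mem_nhds h1)] with x hx hx2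
      exact ⟨hx.1, le_of_lt hx2⟩
    · have := (dl r ⟨hr.1, h1.le⟩).union (dr r ⟨h1.ge, hr.2⟩)
      rwa [Icc_union_Icc_eq_Icc hz.le hz1.le] at this
    · apply (dr r ⟨h1.le, hr.2⟩).mono_of_mem_nhdsWithin
      filter_upwards [self_mem_nhdsWithin, nhdsWithin_le_nhds (Ioi_mem_nhds h1)] with x hx hx2
      exact ⟨le_of_lt hx2, hx.2⟩
  have cu := cont_of_dv du
  have hu0 : 0 < u 0 := by
    rw [ul 0 hz.le]
    have := hpos 0 le_rfl hz
    positivity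
  have main := hE u u' cu' du (by rw [ul' 0 hz.le, S.z0]) (by rw [ur 1 hz1.le]; simp)
    ⟨0, by simp, hu0.ne'⟩
  have cD : ContinuousOn (fun r => h r * |u r| ^ p) (Icc 0 1) := S.hc.mul (abs_rpow_cont hp cu)
  have cN : ContinuousOn (fun r => |u' r| ^ p) (Icc 0 1) := abs_rpow_cont hp cu'
  have c1 : ContinuousOn (fun r => |v' r| ^ p) (Icc 0 1) := abs_rpow_cont hp S.cv'
  have c2 : ContinuousOn (fun r => h r * |v r| ^ p) (Icc 0 1) := S.hc.mul (abs_rpow_cont hp S.cv)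
  have c3 : ContinuousOn (fun r => h r * phi p (v r)) (Icc 0 1) := S.hc.mul S.cphiv
  have hzI : z ∈ Icc (0:ℝ) 1 := ⟨hz.le, hz1.le⟩
  rw [← intervalIntegral.integral_add_adjacent_intervals
      (ii_of_cont le_rfl hz.le hz1.le cD) (ii_of_cont hz.le hz1.le le_rfl cD),
    ← intervalIntegral.integral_add_adjacent_intervals
      (ii_of_cont le_rfl hz.le hz1.le cN) (ii_of_cont hz.le hz1.le le_rfl cN)] at main
  have n1 : ∫ r in (0:ℝ)..z, |u' r| ^ p = ∫ r in (0:ℝ)..z, |v' r| ^ p := by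
    apply intervalIntegral.integral_congr
    intro r hr
    rw [uIcc_of_le hz.le] at hr
    simp only [ul' r hr.2]
  have n2 : ∫ r in z..1, |u' r| ^ p ≤ m ^ p * τ / 2 := by
    have e : ∫ r in z..1, m ^ p / τ * (1 - r) = m ^ p * τ / 2 := by
      rw [intervalIntegral.integral_const_mul, intervalIntegral.integral_sub (by simp) (by simp)]
      simp only [intervalIntegral.integral_const, integral_id, smul_eq_mul]
      have : z = 1 - τ := by linarith
      rw [this]
      field_simp
      ring
    rw [← e]
    apply intervalIntegral.integral_mono_on hz1.le (ii_of_cont hz.le hz1.le le_rfl cN)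
      (Continuous.intervalIntegrable (by fun_prop) _ _)
    intro r hr
    have hq0 : 0 ≤ (1 - r) / τ := div_nonneg (by linarith [hr.2]) hτp.le
    have hq1 : (1 - r) / τ ≤ 1 := by rw [div_le_one hτp]; linarith [hr.1]
    have e2 : |u' r| = m * ((1 - r) / τ) := by
      rw [ur' r hr.1, abs_neg, show m / τ * (1 - r) = m * ((1 - r) / τ) by ring,
        abs_of_nonneg (by positivity)]
    rw [e2, Real.mul_rpow hmp.le hq0, show m ^ p / τ * (1 - r) = m ^ p * ((1 - r) / τ) by ring]
    have := Real.rpow_le_self_of_le_one hq0 hq1 (show 1 ≤ p by linarith)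
    gcongr
  have n3 : ∫ r in (0:ℝ)..z, |v' r| ^ p ≤ m ^ p := by
    have : ∫ r in (0:ℝ)..z, |v' r| ^ p ≤ ∫ r in (0:ℝ)..z, m ^ p := by
      apply intervalIntegral.integral_mono_on hz.le (ii_of_cont le_rfl hz.le hz1.le c1) (by simp)
      intro r hr
      have h1 := hanti (left_mem_Icc.mpr hz.le) hr hr.1
      have h2 := hanti hr (right_mem_Icc.mpr hz.le) hr.2
      rw [S.z0] at h1
      apply Real.rpow_le_rpow (abs_nonneg _) _ (by linarith)
      rw [abs_of_nonpos h1]; linarith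
    rw [intervalIntegral.integral_const, smul_eq_mul, sub_zero] at this
    exact this.trans (mul_le_of_le_one_left (by positivity) hz1.le)
  have n0 : 0 ≤ ∫ r in (0:ℝ)..z, |v' r| ^ p :=
    intervalIntegral.integral_nonneg hz.le (fun r _ => by positivity)
  have d2 : 0 ≤ ∫ r in z..1, h r * |u r| ^ p :=
    intervalIntegral.integral_nonneg hz1.le (fun r hr => by
      have := S.h0 r ⟨hz.le.trans hr.1, hr.2⟩
      positivity)
  have d1 : (∫ r in (0:ℝ)..z, h r * |v r| ^ p) + p * (m * τ / 2) *
      (∫ r in (0:ℝ)..z, h r * phi p (v r)) ≤ ∫ r in (0:ℝ)..z, h r * |u r| ^ p := by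
    have i2 := ii_of_cont le_rfl hz.le hz1.le c2
    have i3 := (ii_of_cont le_rfl hz.le hz1.le c3).const_mul (p * (m * τ / 2))
    rw [← intervalIntegral.integral_const_mul, ← intervalIntegral.integral_add i2 i3]
    apply intervalIntegral.integral_mono_on hz.le (i2.add i3) (ii_of_cont le_rfl hz.le hz1.le cD)
    intro r hr
    have hv : 0 ≤ v r := by
      rcases hr.2.eq_or_lt with e | e
      · rw [e, hvz]
      · exact (hpos r hr.1 e).le
    have hh := S.h0 r ⟨hr.1, hr.2.trans hz1.le⟩
    have hs : 0 ≤ v r + m * τ / 2 := by positivity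
    have t := tangent hp hv hs
    rw [ul r hr.2, abs_of_nonneg hv, abs_of_nonneg hs, phi_of_nonneg hp hv]
    have := mul_le_mul_of_nonneg_left t hh
    refine le_trans (le_of_eq ?_) this
    ring
  set I0 := ∫ r in (0:ℝ)..z, |v' r| ^ p
  set I1 := ∫ r in (0:ℝ)..z, h r * |v r| ^ p
  set I2 := ∫ r in (0:ℝ)..z, h r * phi p (v r)
  have hP : m ^ p = m * m ^ (p - 1) := by
    rw [mul_comm, ← Real.rpow_add_one hmp.ne']; congr 1; ring
  have hPp : 0 < m ^ p := by positivity
  rw [n1] at main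
  have m1 : E1 * (I1 + p * (m * τ / 2) * I2) ≤ I0 + m ^ p * τ / 2 := by
    have := mul_le_mul_of_nonneg_left (show I1 + p * (m * τ / 2) * I2 ≤
      (∫ r in (0:ℝ)..z, h r * |u r| ^ p) + ∫ r in z..1, h r * |u r| ^ p by linarith) hE1
    linarith
  have m2 : E1 * (I0 + p * (τ / 2) * m ^ p) ≤ L * (I0 + m ^ p * τ / 2) := by
    have := mul_le_mul_of_nonneg_left m1 hL.le
    refine le_trans (le_of_eq ?_) this
    rw [hP, hen, hfl]; ring
  set P := m ^ p
  have m3 : E1 * (I0 + τ * P) ≤ L * (I0 + P * τ / 2) := by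
    refine le_trans (mul_le_mul_of_nonneg_left ?_ hE1) m2
    have : 0 ≤ τ * P := by positivity
    nlinarith
  have m4 : P / (2 * A) ≤ (L - E1) * (I0 + τ * P) := by
    have h1 : P / (2 * A) ≤ L * (τ * P / 2) := by
      rw [div_le_iff₀ (by positivity)]
      nlinarith
    nlinarith
  have hpos' : 0 < L - E1 := by
    by_contra hcon
    push Not at hcon
    have h1 : 0 < P / (2 * A) := by positivity
    have h2 : 0 ≤ I0 + τ * P := by positivity
    nlinarith
  have m5 : (L - E1) * (I0 + τ * P) ≤ (L - E1) * (2 * P) := by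
    apply mul_le_mul_of_nonneg_left _ hpos'.le
    have : τ * P ≤ P := mul_le_of_le_one_left hPp.le (by linarith)
    linarith
  have m6 : P / (2 * A) ≤ (L - E1) * (2 * P) := m4.trans m5
  have m7 : P / (2 * A) = 1 / (4 * A) * (2 * P) := by field_simp; norm_num
  rw [m7] at m6
  have := le_of_mul_le_mul_right m6 (by positivity)
  linarith

lemma denom_pos {p : ℝ} (hp : 2 ≤ p) {a : ℝ → ℝ}
    (ha : ContinuousOn a (Icc 0 1)) (ha0 : ∀ r ∈ Icc (0:ℝ) 1, 0 ≤ a r)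
    (hanv : ∀ s t : ℝ, 0 ≤ s → s < t → t ≤ 1 → ∃ r ∈ Ioo s t, a r ≠ 0)
    {u : ℝ → ℝ} (cu : ContinuousOn u (Icc 0 1)) (hu : ∃ r ∈ Icc (0:ℝ) 1, u r ≠ 0) :
    0 < ∫ r in (0:ℝ)..1, r ^ (p - 2) * a r * |u r| ^ p := by
  obtain ⟨x, hx, hux⟩ := hu
  have cr : ContinuousOn (fun r : ℝ => r ^ (p - 2)) (Icc 0 1) :=
    continuousOn_id.rpow_const (fun _ _ => Or.inr (by linarith))
  apply intervalIntegral.integral_pos zero_lt_one ((cr.mul ha).mul (abs_rpow_cont hp cu))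
  · intro r hr
    have h1 := ha0 r ⟨hr.1.le, hr.2⟩
    exact mul_nonneg (mul_nonneg (Real.rpow_nonneg hr.1.le _) h1) (Real.rpow_nonneg (abs_nonneg _) _)
  · have hev := (cu x hx).eventually_ne hux
    rw [eventually_nhdsWithin_iff, Metric.eventually_nhds_iff] at hev
    obtain ⟨ε, hε, hb⟩ := hev
    obtain ⟨r, hr, har⟩ := hanv (max 0 (x - ε)) (min 1 (x + ε)) (le_max_left _ _)
      (by
        apply max_lt <;> apply lt_min <;> linarith [hx.1, hx.2]) (min_le_left _ _)
    have h1 := max_lt_iff.mp hr.1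
    have h2 := lt_min_iff.mp hr.2
    have hrI : r ∈ Icc (0:ℝ) 1 := ⟨h1.1.le, h2.1.le⟩
    have hur : u r ≠ 0 := hb (by rw [Real.dist_eq, abs_lt]; constructor <;> linarith) hrI
    refine ⟨r, hrI, ?_⟩
    have h3 : 0 < a r := lt_of_le_of_ne (ha0 r hrI) (Ne.symm har)
    have h4 : 0 < |u r| := abs_pos.mpr hur
    exact mul_pos (mul_pos (Real.rpow_pos_of_pos h1.1 _) h3) (Real.rpow_pos_of_pos h4 _)

theorem stmt4 (p : ℝ) (hp : 2 ≤ p) (a : ℝ → ℝ)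
    (ha : ContinuousOn a (Icc 0 1)) (ha0 : ∀ r ∈ Icc (0:ℝ) 1, 0 ≤ a r)
    (hanv : ∀ s t : ℝ, 0 ≤ s → s < t → t ≤ 1 → ∃ r ∈ Ioo s t, a r ≠ 0) :
    ∃ δ : ℝ, mu1 a p < δ ∧
      ∀ μ : ℝ, 0 < μ → μ < δ → μ ≠ mu1 a p →
        ∀ v v' : ℝ → ℝ, APSol p μ a v v' → ∀ r ∈ Icc (0:ℝ) 1, v r = 0 := by
  have hp1 : 0 < p - 1 := by linarith
  set h : ℝ → ℝ := fun r => (p - 1) * r ^ (p - 2) * a r with hh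
  have cr : ContinuousOn (fun r : ℝ => r ^ (p - 2)) (Icc 0 1) :=
    continuousOn_id.rpow_const (fun _ _ => Or.inr (by linarith))
  have hc : ContinuousOn h (Icc 0 1) := (continuousOn_const.mul cr).mul ha
  have h0 : ∀ r ∈ Icc (0:ℝ) 1, 0 ≤ h r := fun r hr => by
    have h1 := ha0 r hr
    have h2 := hr.1
    exact mul_nonneg (mul_nonneg hp1.le (Real.rpow_nonneg h2 _)) h1
  obtain ⟨A0, hA0⟩ := isCompact_Icc.exists_bound_of_continuousOn hc
  have hA00 : 0 ≤ A0 := (norm_nonneg _).trans (hA0 0 (by simp))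
  obtain ⟨A, hAd⟩ : ∃ A, A = A0 + 1 := ⟨_, rfl⟩
  have hAp : 0 < A := by linarith
  have hA : ∀ r ∈ Icc (0:ℝ) 1, h r ≤ A := fun r hr => by
    have := (le_abs_self _).trans (hA0 r hr)
    linarith
  have hD : ∀ u : ℝ → ℝ, ∫ r in (0:ℝ)..1, h r * |u r| ^ p =
      (p - 1) * ∫ r in (0:ℝ)..1, r ^ (p - 2) * a r * |u r| ^ p := fun u => by
    rw [← intervalIntegral.integral_const_mul]
    congr 1
    ext r
    simp only [hh]; ring
  have hN0 : ∀ u : ℝ → ℝ, 0 ≤ ∫ r in (0:ℝ)..1, |u r| ^ p := fun u =>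
    intervalIntegral.integral_nonneg zero_le_one (fun r _ => by positivity)
  have hD0 : ∀ u : ℝ → ℝ, 0 ≤ ∫ r in (0:ℝ)..1, h r * |u r| ^ p := fun u =>
    intervalIntegral.integral_nonneg zero_le_one (fun r hr => by
      exact mul_nonneg (h0 r hr) (by positivity))
  have hE1 : 0 ≤ eta1 a p := by
    apply Real.sInf_nonneg
    rintro q ⟨u, u', -, -, -, -, -, rfl⟩
    rw [← hD]
    exact div_nonneg (hN0 _) (hD0 _)
  have hE : ∀ u u' : ℝ → ℝ, ContinuousOn u' (Icc 0 1) →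
      (∀ r ∈ Icc (0:ℝ) 1, HasDerivWithinAt u (u' r) (Icc 0 1) r) → u' 0 = 0 → u 1 = 0 →
      (∃ r ∈ Icc (0:ℝ) 1, u r ≠ 0) →
      eta1 a p * ∫ r in (0:ℝ)..1, h r * |u r| ^ p ≤ ∫ r in (0:ℝ)..1, |u' r| ^ p := by
    intro u u' cu' du hu0 hu1 hne
    have hdp := denom_pos hp ha ha0 hanv (cont_of_dv du) hne
    have : eta1 a p ≤ (∫ r in (0:ℝ)..1, |u' r| ^ p) / ∫ r in (0:ℝ)..1, h r * |u r| ^ p := by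
      apply csInf_le
      · refine ⟨0, ?_⟩
        rintro q ⟨u, u', -, -, -, -, -, rfl⟩
        rw [← hD]
        exact div_nonneg (hN0 _) (hD0 _)
      · exact ⟨u, u', cu', du, hu0, hu1, hne, by rw [hD]⟩
    rwa [le_div_iff₀ (by rw [hD]; positivity)] at this
  -- the dichotomy
  have dich : ∀ (L : ℝ) (v v' : ℝ → ℝ), Sol p L h v v' → 0 < v 0 →
      L = eta1 a p ∨ eta1 a p + 1 / (4 * A) ≤ L := by
    intro L v v' S hv
    obtain ⟨z, hz, hz1, hvz, hpos⟩ := S.first_zero hv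
    rcases hz1.eq_or_lt with rfl | hz1
    · left
      have hne : ∃ r ∈ Icc (0:ℝ) 1, v r ≠ 0 := ⟨0, by simp, hv.ne'⟩
      apply le_antisymm
      · apply le_csInf
        · exact ⟨_, v, v', S.cv', S.dv, S.z0, S.z1, hne, rfl⟩
        · rintro q ⟨u, u', cu', du, -, hu1, hune, rfl⟩
          have hdp := denom_pos hp ha ha0 hanv (cont_of_dv du) hune
          rw [le_div_iff₀ (by positivity), ← hD]
          exact S.picone hpos cu' du hu1
      · have h1 := hE v v' S.cv' S.dv S.z0 S.z1 hne
        rw [S.energy hz le_rfl hvz] at h1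
        refine le_of_mul_le_mul_right h1 ?_
        have hdp := denom_pos hp ha ha0 hanv S.cv hne
        rw [hD]; positivity
    · right
      exact S.gap hAp hE1 hA hE hz hz1 hvz hpos
  have hq : 0 < 1 / (p - 1) := by positivity
  have hg : 0 < 1 / (4 * A) := by positivity
  refine ⟨(eta1 a p + 1 / (4 * A)) ^ (1 / (p - 1)), ?_, ?_⟩
  · unfold mu1
    exact Real.rpow_lt_rpow hE1 (by linarith) hq
  · intro μ hμ hμδ hμne v v' hsol
    obtain ⟨cv', dv, dphi, z0, z1⟩ := hsol
    have S : Sol p (μ ^ (p - 1)) h v v' :=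
      { hp := hp, hL := by positivity, hc := hc, h0 := h0, cv' := cv', dv := dv
        dphi := fun r hr => by
          refine (dphi r hr).congr_deriv ?_
          simp only [hh, phi]; ring
        z0 := z0, z1 := z1 }
    have hback : (μ ^ (p - 1)) ^ (1 / (p - 1)) = μ := by
      rw [← Real.rpow_mul hμ.le, mul_one_div_cancel hp1.ne', Real.rpow_one]
    have hno : ¬ (μ ^ (p - 1) = eta1 a p ∨ eta1 a p + 1 / (4 * A) ≤ μ ^ (p - 1)) := by
      rintro (e | e)
      · apply hμne
        rw [mu1, ← e, hback]
      · have := Real.rpow_le_rpow (by linarith) e hq.le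
        rw [hback] at this
        linarith
    rcases lt_trichotomy (v 0) 0 with e | e | e
    · exact absurd (dich _ _ _ S.neg (by simpa using e)) hno
    · exact S.uniq hA e
    · exact absurd (dich _ _ _ S e) hno
end

section
/- The principal eigenvalue function p ↦ μ₁(p) is continuous on [2, +∞). -/
open Set Filter Topology intervalIntegral

lemma pw1 {x p q : ℝ} (hx : 0 ≤ x) (hp : 0 < p) (hpq : p ≤ q) :
    x ^ p ≤ 1 + (p / q) * (x ^ q - 1) := by
  have hq : 0 < q := lt_of_lt_of_le hp hpq
  have h := one_add_mul_self_le_rpow_one_add (s := x ^ p - 1)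
    (by linarith [Real.rpow_nonneg hx p]) (p := q / p) (by rw [le_div_iff₀ hp]; linarith)
  have e : (1 + (x ^ p - 1)) ^ (q / p) = x ^ q := by
    rw [add_sub_cancel, ← Real.rpow_mul hx]; congr 1; field_simp
  rw [e] at h
  have h2 : (p / q) * (1 + q / p * (x ^ p - 1)) ≤ (p / q) * x ^ q :=
    mul_le_mul_of_nonneg_left h (by positivity)
  have h3 : (p / q) * (1 + q / p * (x ^ p - 1)) = p / q + (x ^ p - 1) := by field_simp
  linarith

lemma pw2 {t α β : ℝ} (ht : 0 ≤ t) (ht1 : t ≤ 1) (hα : 0 < α) (hab : α ≤ β) :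
    t ^ α - t ^ β ≤ (β - α) / α := by
  have h := one_add_mul_self_le_rpow_one_add (s := t ^ α - 1)
    (by linarith [Real.rpow_nonneg ht α]) (p := β / α) (by rw [le_div_iff₀ hα]; linarith)
  have e : (1 + (t ^ α - 1)) ^ (β / α) = t ^ β := by
    rw [add_sub_cancel, ← Real.rpow_mul ht]; congr 1; field_simp
  rw [e] at h
  have hu := Real.rpow_nonneg ht α
  have h0 : 0 ≤ (β - α) / α := div_nonneg (by linarith) hα.le
  have h1 : (β - α) / α = β / α - 1 := by field_simp
  rw [h1] at h0 ⊢
  nlinarith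

lemma pw3 {x y e p : ℝ} (hx : 0 ≤ x) (hx1 : x ≤ 1) (hy : 0 ≤ y) (he : 0 ≤ e)
    (hxy : x - e ≤ y) (hp : 1 ≤ p) : x ^ p - y ^ p ≤ p * e := by
  rcases hx.eq_or_lt with rfl | hx0
  · rw [Real.zero_rpow (by linarith)]
    have := Real.rpow_nonneg hy p
    have : 0 ≤ p * e := by positivity
    linarith
  rcases le_or_gt x y with h | h
  · have := Real.rpow_le_rpow hx h (by linarith : 0 ≤ p)
    have : 0 ≤ p * e := by positivity
    linarith
  have hb := one_add_mul_self_le_rpow_one_add (s := y / x - 1)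
    (by have : 0 ≤ y / x := by positivity
        linarith) hp
  rw [add_sub_cancel, Real.div_rpow hy hx, le_div_iff₀ (by positivity)] at hb
  have hxp : x ^ p ≤ x := by
    have := Real.rpow_le_rpow_of_exponent_ge hx0 hx1 hp
    simpa using this
  have hxp0 : 0 ≤ x ^ p := by positivity
  have h1 : (1 + p * (y / x - 1)) * x ^ p = x ^ p - p * (x - y) * (x ^ p / x) := by
    field_simp; ring
  have h2 : x ^ p / x ≤ 1 := by rw [div_le_one hx0]; exact hxp
  have h3 : p * (x - y) * (x ^ p / x) ≤ p * (x - y) * 1 :=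
    mul_le_mul_of_nonneg_left h2 (mul_nonneg (by linarith) (by linarith))
  have h4 : p * (x - y) ≤ p * e := mul_le_mul_of_nonneg_left (by linarith) (by linarith)
  linarith

lemma pw4 {w s q : ℝ} (hw : 0 ≤ w) (hs : 0 < s) (hs1 : s ≤ 1) (hq : 2 ≤ q) :
    w - w ^ s ≤ (1 - s) * w ^ q := by
  have hq0 := Real.rpow_nonneg hw q
  have h0 : 0 ≤ (1 - s) * w ^ q := mul_nonneg (by linarith) hq0
  rcases hw.eq_or_lt with rfl | hw0
  · rw [Real.zero_rpow hs.ne']; linarith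
  rcases le_or_gt w 1 with h | h
  · have := Real.rpow_le_rpow_of_exponent_ge hw0 h hs1
    rw [Real.rpow_one] at this
    linarith
  have h1 := pw1 hw hs hs1
  have hb := rpow_one_add_le_one_add_mul_self (s := w - 1) (by linarith) (p := 1 - s)
    (by linarith) (by linarith)
  rw [add_sub_cancel] at hb
  have e : w ^ s * w ^ (1 - s) = w := by
    rw [← Real.rpow_add hw0]; simp
  have h2 : w ^ s ≤ w := by
    have := Real.rpow_le_rpow_of_exponent_le h.le hs1
    simpa using this
  have h3 : w ^ (2:ℝ) ≤ w ^ q := Real.rpow_le_rpow_of_exponent_le h.le hq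
  rw [Real.rpow_two] at h3
  have h4 : 0 ≤ w ^ s := Real.rpow_nonneg hw s
  calc w - w ^ s = w ^ s * (w ^ (1 - s) - 1) := by rw [mul_sub, e]; ring
    _ ≤ w ^ s * ((1 - s) * (w - 1)) := mul_le_mul_of_nonneg_left (by linarith) h4
    _ ≤ w * ((1 - s) * (w - 1)) :=
        mul_le_mul_of_nonneg_right h2 (mul_nonneg (by linarith) (by linarith))
    _ = (1 - s) * (w * (w - 1)) := by ring
    _ ≤ (1 - s) * w ^ q := mul_le_mul_of_nonneg_left (by nlinarith) (by linarith)

/-- numerator -/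
noncomputable def NN (p : ℝ) (w : ℝ → ℝ) : ℝ := ∫ r in (0:ℝ)..1, |w r| ^ p
/-- denominator -/
noncomputable def DD (a : ℝ → ℝ) (p : ℝ) (v : ℝ → ℝ) : ℝ :=
  ∫ r in (0:ℝ)..1, r ^ (p - 2) * a r * |v r| ^ p
/-- primitive vanishing at one -/
noncomputable def VV (w : ℝ → ℝ) (r : ℝ) : ℝ := ∫ x in r..1, w x
/-- nice class -/
def WW (w : ℝ → ℝ) : Prop := Continuous w ∧ (∀ r, 0 ≤ w r) ∧ w 0 = 0

/-- nice weights -/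
def AA (M : ℝ) (a : ℝ → ℝ) : Prop := Continuous a ∧ (∀ r, 0 ≤ a r) ∧ (∀ r, a r ≤ M) ∧ 0 < M ∧
  (∀ s t : ℝ, 0 ≤ s → s < t → t ≤ 1 → ∃ r ∈ Ioo s t, a r ≠ 0)

lemma VV_deriv {w : ℝ → ℝ} (hw : Continuous w) (r : ℝ) : HasDerivAt (VV w) (-w r) r :=
  integral_hasDerivAt_left (hw.intervalIntegrable _ _)
    hw.aestronglyMeasurable.stronglyMeasurableAtFilter hw.continuousAt

lemma VV_cont {w : ℝ → ℝ} (hw : Continuous w) : Continuous (VV w) :=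
  continuous_iff_continuousAt.2 fun r => (VV_deriv hw r).continuousAt

lemma VV_nonneg {w : ℝ → ℝ} (hw : WW w) {r : ℝ} (hr : r ≤ 1) : 0 ≤ VV w r :=
  intervalIntegral.integral_nonneg hr fun x _ => hw.2.1 x

lemma NN_int {w : ℝ → ℝ} (hw : Continuous w) {p : ℝ} (hp : 0 ≤ p) (a b : ℝ) :
    IntervalIntegrable (fun r => |w r| ^ p) MeasureTheory.volume a b :=
  (hw.abs.rpow_const fun _ => Or.inr hp).intervalIntegrable _ _

lemma DD_cont {a v : ℝ → ℝ} (ha : Continuous a) (hv : Continuous v) {p : ℝ} (hp : 2 ≤ p) :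
    Continuous (fun r => r ^ (p - 2) * a r * |v r| ^ p) :=
  ((continuous_id.rpow_const fun _ => Or.inr (by linarith)).mul ha).mul
    (hv.abs.rpow_const fun _ => Or.inr (by linarith))

lemma NN_nonneg (p : ℝ) (w : ℝ → ℝ) : 0 ≤ NN p w :=
  intervalIntegral.integral_nonneg zero_le_one fun x _ => Real.rpow_nonneg (abs_nonneg _) _

lemma DD_nonneg {a : ℝ → ℝ} (ha : ∀ r, 0 ≤ a r) (p : ℝ) (v : ℝ → ℝ) : 0 ≤ DD a p v :=
  intervalIntegral.integral_nonneg zero_le_one fun x hx =>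
    mul_nonneg (mul_nonneg (Real.rpow_nonneg hx.1 _) (ha x)) (Real.rpow_nonneg (abs_nonneg _) _)

lemma NN_mono {w : ℝ → ℝ} (hw : Continuous w) {p q : ℝ} (hp : 0 < p) (hpq : p ≤ q)
    (h : NN q w ≤ 1) : NN p w ≤ 1 := by
  have hq : 0 < q := lt_of_lt_of_le hp hpq
  have hi : IntervalIntegrable (fun r => 1 + (p / q) * (|w r| ^ q - 1)) MeasureTheory.volume 0 1 :=
    (continuous_const.add (continuous_const.mul
      ((hw.abs.rpow_const fun _ => Or.inr hq.le).sub continuous_const))).intervalIntegrable _ _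
  have h1 : NN p w ≤ ∫ r in (0:ℝ)..1, (1 + (p / q) * (|w r| ^ q - 1)) :=
    intervalIntegral.integral_mono_on zero_le_one (NN_int hw hp.le _ _) hi
      fun x _ => pw1 (abs_nonneg _) hp hpq
  have h2 : ∫ r in (0:ℝ)..1, (1 + (p / q) * (|w r| ^ q - 1)) = 1 + (p / q) * (NN q w - 1) := by
    have hi' := NN_int hw hq.le 0 1
    rw [intervalIntegral.integral_add (by simp) ((hi'.sub (by simp)).const_mul _),
      intervalIntegral.integral_const_mul, intervalIntegral.integral_sub hi' (by simp)]
    simp [NN]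
  have : (p / q) * (NN q w - 1) ≤ 0 := mul_nonpos_of_nonneg_of_nonpos (by positivity) (by linarith)
  linarith

lemma VV_le_one {w : ℝ → ℝ} (hw : WW w) {q : ℝ} (hq : 1 ≤ q) (h : NN q w ≤ 1) {r : ℝ}
    (hr : r ∈ Icc (0:ℝ) 1) : VV w r ≤ 1 := by
  have h1 := NN_mono hw.1 one_pos hq h
  have h2 : NN 1 w = ∫ r in (0:ℝ)..1, w r := by
    unfold NN; congr 1; ext x; rw [Real.rpow_one, abs_of_nonneg (hw.2.1 x)]
  rw [h2] at h1
  refine le_trans ?_ h1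
  exact intervalIntegral.integral_mono_interval hr.1 hr.2 le_rfl
    (Filter.Eventually.of_forall fun x => hw.2.1 x) (hw.1.intervalIntegrable _ _)

lemma eta_bdd {M : ℝ} {a : ℝ → ℝ} (ha : AA M a) {p : ℝ} (hp : 2 ≤ p) : BddBelow { q : ℝ | ∃ v v' : ℝ → ℝ,
    ContinuousOn v' (Icc 0 1) ∧
    (∀ r ∈ Icc (0:ℝ) 1, HasDerivWithinAt v (v' r) (Icc 0 1) r) ∧
    v' 0 = 0 ∧ v 1 = 0 ∧ (∃ r ∈ Icc (0:ℝ) 1, v r ≠ 0) ∧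
    q = (∫ r in (0:ℝ)..1, |v' r| ^ p) /
        ((p - 1) * ∫ r in (0:ℝ)..1, r ^ (p - 2) * a r * |v r| ^ p) } := by
  refine ⟨0, ?_⟩
  rintro q ⟨v, v', -, -, -, -, -, rfl⟩
  exact div_nonneg (NN_nonneg p v') (mul_nonneg (by linarith) (DD_nonneg ha.2.1 p v))

lemma lemA {M : ℝ} {a : ℝ → ℝ} (ha : AA M a) {p : ℝ} (hp : 2 ≤ p) {w : ℝ → ℝ} (hw : WW w) :
    ((p - 1) * eta1 a p) * DD a p (VV w) ≤ NN p w := by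
  rcases (DD_nonneg ha.2.1 p (VV w)).eq_or_lt with h | h
  · rw [← h, mul_zero]; exact NN_nonneg p w
  have hne : ∃ r ∈ Icc (0:ℝ) 1, VV w r ≠ 0 := by
    by_contra! hc
    have : DD a p (VV w) = ∫ r in (0:ℝ)..1, (0:ℝ) := by
      apply intervalIntegral.integral_congr
      intro r hr
      rw [uIcc_of_le zero_le_one] at hr
      simp only [hc r hr, abs_zero, Real.zero_rpow (by linarith : p ≠ 0), mul_zero]
    rw [this] at h
    simp at h
  have hle : eta1 a p ≤ NN p w / ((p - 1) * DD a p (VV w)) := by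
    apply csInf_le (eta_bdd ha hp)
    refine ⟨VV w, fun r => -w r, hw.1.neg.continuousOn,
      fun r _ => (VV_deriv hw.1 r).hasDerivWithinAt, by simp [hw.2.2], by simp [VV], hne, ?_⟩
    simp [NN, DD]
  have hpp : 0 < (p - 1) * DD a p (VV w) := mul_pos (by linarith) h
  rw [le_div_iff₀ hpp] at hle
  linarith

lemma DD_pos {M : ℝ} {a : ℝ → ℝ} (ha : AA M a) {p : ℝ} (hp : 2 ≤ p) {v : ℝ → ℝ}
    (hv : ContinuousOn v (Icc 0 1)) (hne : ∃ r ∈ Icc (0:ℝ) 1, v r ≠ 0) : 0 < DD a p v := by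
  obtain ⟨r, hr, hvr⟩ := hne
  have hev : ∀ᶠ x in 𝓝[Icc 0 1] r, v x ≠ 0 := (hv r hr).eventually_ne hvr
  rw [eventually_nhdsWithin_iff, Metric.eventually_nhds_iff] at hev
  obtain ⟨ε, hε, hball⟩ := hev
  obtain ⟨s, t, hs, hst, ht, hsub⟩ : ∃ s t : ℝ, 0 ≤ s ∧ s < t ∧ t ≤ 1 ∧
      ∀ x ∈ Ioo s t, dist x r < ε := by
    refine ⟨max 0 (r - ε), min 1 (r + ε), le_max_left _ _, ?_, min_le_left _ _, ?_⟩
    · rw [max_lt_iff, lt_min_iff, lt_min_iff]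
      refine ⟨⟨by norm_num, by linarith [hr.1]⟩, by linarith [hr.2], by linarith⟩
    · intro x hx
      rw [Real.dist_eq, abs_lt]
      have h1 := lt_of_le_of_lt (le_max_right _ _) hx.1
      have h2 := lt_of_lt_of_le hx.2 (min_le_right _ _)
      constructor <;> linarith
  obtain ⟨x, hx, hax⟩ := ha.2.2.2.2 s t hs hst ht
  have hx0 : 0 < x := lt_of_le_of_lt hs hx.1
  have hx1 : x < 1 := lt_of_lt_of_le hx.2 ht
  have hvx : v x ≠ 0 := hball (hsub x hx) ⟨hx0.le, hx1.le⟩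
  apply intervalIntegral.integral_pos zero_lt_one
  · exact ((continuous_id.rpow_const fun _ => Or.inr (by linarith)).mul ha.1).continuousOn.mul
      (hv.abs.rpow_const fun _ _ => Or.inr (by linarith))
  · intro y hy
    exact mul_nonneg (mul_nonneg (Real.rpow_nonneg hy.1.le _) (ha.2.1 y))
      (Real.rpow_nonneg (abs_nonneg _) _)
  · refine ⟨x, ⟨hx0.le, hx1.le⟩, ?_⟩
    have : 0 < a x := lt_of_le_of_ne (ha.2.1 x) (Ne.symm hax)
    have : 0 < |v x| := abs_pos.2 hvx
    positivity

lemma VV_smul (t : ℝ) (w : ℝ → ℝ) (r : ℝ) : VV (fun x => t * w x) r = t * VV w r :=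
  intervalIntegral.integral_const_mul _ _

lemma NN_smul {t : ℝ} (ht : 0 ≤ t) (p : ℝ) (w : ℝ → ℝ) :
    NN p (fun x => t * w x) = t ^ p * NN p w := by
  unfold NN
  rw [← intervalIntegral.integral_const_mul]
  congr 1; ext x
  rw [abs_mul, abs_of_nonneg ht, Real.mul_rpow ht (abs_nonneg _)]

lemma DD_smul {t : ℝ} (ht : 0 ≤ t) (a : ℝ → ℝ) (p : ℝ) (w : ℝ → ℝ) :
    DD a p (VV (fun x => t * w x)) = t ^ p * DD a p (VV w) := by
  unfold DD
  rw [← intervalIntegral.integral_const_mul]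
  congr 1; ext x
  rw [VV_smul, abs_mul, abs_of_nonneg ht, Real.mul_rpow ht (abs_nonneg _)]
  ring

lemma WW_smul {t : ℝ} (ht : 0 ≤ t) {w : ℝ → ℝ} (hw : WW w) : WW (fun x => t * w x) :=
  ⟨continuous_const.mul hw.1, fun r => mul_nonneg ht (hw.2.1 r), by simp [hw.2.2]⟩

lemma lemB {M : ℝ} {a : ℝ → ℝ} (ha : AA M a) {p c : ℝ} (hp : 2 ≤ p) (hc : 0 ≤ c)
    (h : ∀ w, WW w → NN p w = 1 → c * DD a p (VV w) ≤ 1) : c ≤ (p - 1) * eta1 a p := by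
  have hp1 : 0 < p - 1 := by linarith
  rw [← div_le_iff₀' hp1]
  apply le_csInf
  · refine ⟨_, fun r => 1 - r ^ 2, fun r => - (2 * r), by fun_prop, ?_, by simp, by simp,
      ⟨0, by simp, by simp⟩, rfl⟩
    intro r _
    have := ((hasDerivAt_pow 2 r).const_sub 1).hasDerivWithinAt (s := Icc (0:ℝ) 1)
    simpa using this
  rintro q ⟨v, v', hv', hd, hv0, hv1, hne, rfl⟩
  have hvc : ContinuousOn v (Icc 0 1) := fun r hr => (hd r hr).continuousWithinAt
  have hD := DD_pos ha hp hvc hne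
  change c / (p - 1) ≤ NN p v' / ((p - 1) * DD a p v)
  rw [div_le_div_iff₀ hp1 (mul_pos hp1 hD)]
  suffices hs : c * DD a p v ≤ NN p v' by nlinarith
  set w : ℝ → ℝ := IccExtend (zero_le_one' ℝ) (fun x : Icc (0:ℝ) 1 => |v' x|) with hwdef
  have hwm : ∀ x ∈ Icc (0:ℝ) 1, w x = |v' x| := fun x hx => IccExtend_of_mem _ _ hx
  have hw : WW w := by
    refine ⟨Continuous.Icc_extend' (continuousOn_iff_continuous_domRestrict.1 hv'.abs), fun r => ?_, ?_⟩
    · exact abs_nonneg _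
    · rw [hwm 0 (by simp), hv0, abs_zero]
  have hN : NN p w = NN p v' := by
    apply intervalIntegral.integral_congr
    intro r hr
    rw [uIcc_of_le zero_le_one] at hr
    simp only [hwm r hr, abs_abs]
  have hVv : ∀ r ∈ Icc (0:ℝ) 1, |v r| ≤ VV w r := by
    intro r hr
    have hsub : Icc r 1 ⊆ Icc (0:ℝ) 1 := Icc_subset_Icc hr.1 le_rfl
    have hintv : IntervalIntegrable v' MeasureTheory.volume r 1 :=
      (hv'.mono hsub).intervalIntegrable_of_Icc hr.2
    have h1 : ∫ x in r..1, v' x = v 1 - v r := by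
      apply intervalIntegral.integral_eq_sub_of_hasDeriv_right
      · rw [uIcc_of_le hr.2]; exact hvc.mono hsub
      · intro x hx
        rw [min_eq_left hr.2, max_eq_right hr.2] at hx
        have hx' : x ∈ Ioo (0:ℝ) 1 := ⟨lt_of_le_of_lt hr.1 hx.1, hx.2⟩
        exact ((hd x ⟨hx'.1.le, hx'.2.le⟩).hasDerivAt
          (Icc_mem_nhds hx'.1 hx'.2)).hasDerivWithinAt
      · exact hintv
    have h2 : |v r| = ‖∫ x in r..1, v' x‖ := by
      rw [h1, hv1, zero_sub, norm_neg, Real.norm_eq_abs]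
    rw [h2]
    refine (intervalIntegral.norm_integral_le_integral_norm hr.2).trans (le_of_eq ?_)
    apply intervalIntegral.integral_congr
    intro x hx
    rw [uIcc_of_le hr.2] at hx
    simp only [hwm x (hsub hx), Real.norm_eq_abs]
  have hDD : DD a p v ≤ DD a p (VV w) := by
    apply intervalIntegral.integral_mono_on zero_le_one
    · apply ContinuousOn.intervalIntegrable_of_Icc zero_le_one
      exact ((continuous_id.rpow_const fun _ => Or.inr (by linarith)).mul ha.1).continuousOn.mul
        (hvc.abs.rpow_const fun _ _ => Or.inr (by linarith))
    · exact (DD_cont ha.1 (VV_cont hw.1) hp).intervalIntegrable _ _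
    · intro x hx
      apply mul_le_mul_of_nonneg_left _ (mul_nonneg (Real.rpow_nonneg hx.1 _) (ha.2.1 x))
      apply Real.rpow_le_rpow (abs_nonneg _) _ (by linarith)
      exact (hVv x hx).trans (le_abs_self _)
  rw [← hN]
  have hNpos : 0 < NN p w := by
    rcases (NN_nonneg p w).eq_or_lt with h0 | h0
    · exfalso
      obtain ⟨r, hr, hvr⟩ := hne
      have hVpos : 0 < VV w r := lt_of_lt_of_le (abs_pos.2 hvr) (hVv r hr)
      have := VV_le_one (w := fun x => (2 / VV w r) * w x) (WW_smul (by positivity) hw)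
        (by linarith : 1 ≤ p) (by rw [NN_smul (by positivity), ← h0]; simp) hr
      rw [VV_smul, div_mul_cancel₀ _ hVpos.ne'] at this
      norm_num at this
    · exact h0
  set n := NN p w with hn
  have ht : 0 ≤ n ^ (-(1 / p)) := Real.rpow_nonneg hNpos.le _
  have htp : (n ^ (-(1 / p))) ^ p = n⁻¹ := by
    rw [← Real.rpow_mul hNpos.le, ← Real.rpow_neg_one]
    congr 1
    have : p ≠ 0 := by linarith
    field_simp
  have := h (fun x => n ^ (-(1 / p)) * w x) (WW_smul ht hw)
    (by rw [NN_smul ht, htp, ← hn, inv_mul_cancel₀ hNpos.ne'])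
  rw [DD_smul ht, htp] at this
  have h3 : c * DD a p (VV w) ≤ n := by
    have h4 : c * (n⁻¹ * DD a p (VV w)) * n ≤ 1 * n := mul_le_mul_of_nonneg_right this hNpos.le
    have h5 : c * (n⁻¹ * DD a p (VV w)) * n = c * DD a p (VV w) := by field_simp
    linarith
  exact (mul_le_mul_of_nonneg_left hDD hc).trans h3

lemma L_pos {M : ℝ} {a : ℝ → ℝ} (ha : AA M a) {p : ℝ} (hp : 2 ≤ p) :
    0 < (p - 1) * eta1 a p := by
  have hM := ha.2.2.2.1
  refine lt_of_lt_of_le (inv_pos.2 hM) (lemB ha hp (inv_pos.2 hM).le fun w hw hN => ?_)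
  have : DD a p (VV w) ≤ ∫ r in (0:ℝ)..1, M := by
    apply intervalIntegral.integral_mono_on zero_le_one
      ((DD_cont ha.1 (VV_cont hw.1) hp).intervalIntegrable _ _) (by simp)
    intro x hx
    have h1 : x ^ (p - 2) ≤ 1 := Real.rpow_le_one hx.1 hx.2 (by linarith)
    have h0 : 0 ≤ x ^ (p - 2) := Real.rpow_nonneg hx.1 _
    have h2 : |VV w x| ^ p ≤ 1 := by
      apply Real.rpow_le_one (abs_nonneg _) _ (by linarith)
      rw [abs_of_nonneg (VV_nonneg hw hx.2)]
      exact VV_le_one hw (by linarith) hN.le hx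
    have h3 : 0 ≤ |VV w x| ^ p := Real.rpow_nonneg (abs_nonneg _) _
    calc x ^ (p - 2) * a x * |VV w x| ^ p ≤ 1 * M * 1 := by
          have := ha.2.1 x
          have := ha.2.2.1 x
          gcongr
      _ = M := by ring
  simp at this
  rw [inv_mul_le_iff₀ hM, mul_one]
  exact this

lemma L_mono {M : ℝ} {a : ℝ → ℝ} (ha : AA M a) {p q : ℝ} (hp : 2 ≤ p) (hpq : p ≤ q) :
    (p - 1) * eta1 a p ≤ (q - 1) * eta1 a q := by
  have hL := L_pos ha hp
  refine lemB ha (hp.trans hpq) hL.le fun w hw hN => ?_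
  have hNp := NN_mono hw.1 (by linarith) hpq hN.le
  refine le_trans ?_ ((lemA ha hp hw).trans hNp)
  apply mul_le_mul_of_nonneg_left _ hL.le
  apply intervalIntegral.integral_mono_on_of_le_Ioo zero_le_one
    ((DD_cont ha.1 (VV_cont hw.1) (hp.trans hpq)).intervalIntegrable _ _)
    ((DD_cont ha.1 (VV_cont hw.1) hp).intervalIntegrable _ _)
  intro x hx
  have hx' : x ∈ Icc (0:ℝ) 1 := ⟨hx.1.le, hx.2.le⟩
  have h1 : x ^ (q - 2) ≤ x ^ (p - 2) :=
    Real.rpow_le_rpow_of_exponent_ge hx.1 hx.2.le (by linarith)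
  have h2 : |VV w x| ^ q ≤ |VV w x| ^ p := by
    apply Real.rpow_le_rpow_of_exponent_ge' (abs_nonneg _) _ (by linarith) hpq
    rw [abs_of_nonneg (VV_nonneg hw hx.2.le)]
    exact VV_le_one hw (by linarith) hN.le hx'
  have := ha.2.1 x
  have h3 : 0 ≤ |VV w x| ^ q := Real.rpow_nonneg (abs_nonneg _) _
  have h4 : 0 ≤ x ^ (p - 2) := Real.rpow_nonneg hx.1.le _
  gcongr

lemma NN_tendsto {w : ℝ → ℝ} (hw : Continuous w) {p : ℝ} (hp : 2 ≤ p) :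
    ContinuousWithinAt (fun q => NN q w) (Ici 2) p := by
  apply intervalIntegral.continuousWithinAt_of_dominated_interval
    (bound := fun r => 1 + |w r| ^ (p + 1))
  · filter_upwards [self_mem_nhdsWithin] with q hq
    have hq : (2:ℝ) ≤ q := hq
    exact (hw.abs.rpow_const fun _ => Or.inr (by linarith)).aestronglyMeasurable
  · have h1 : ∀ᶠ q in 𝓝[Ici 2] p, q < p + 1 :=
      nhdsWithin_le_nhds (Iio_mem_nhds (by linarith))
    filter_upwards [self_mem_nhdsWithin, h1] with q hq hq1
    have hq : (2:ℝ) ≤ q := hq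
    refine Filter.Eventually.of_forall fun x _ => ?_
    rw [Real.norm_of_nonneg (Real.rpow_nonneg (abs_nonneg _) _)]
    have h0 := Real.rpow_nonneg (abs_nonneg (w x)) (p + 1)
    rcases le_or_gt (|w x|) 1 with h | h
    · have := Real.rpow_le_one (abs_nonneg _) h (by linarith : 0 ≤ q)
      linarith
    · have := Real.rpow_le_rpow_of_exponent_le h.le hq1.le
      linarith
  · exact (continuous_const.add
      (hw.abs.rpow_const fun _ => Or.inr (by linarith))).intervalIntegrable _ _
  · refine Filter.Eventually.of_forall fun x _ => ?_
    exact (Real.continuousAt_const_rpow' (by linarith : p ≠ 0)).continuousWithinAt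

lemma DD_tendsto {M : ℝ} {a : ℝ → ℝ} (ha : AA M a) {v : ℝ → ℝ} (hv : Continuous v) {p : ℝ}
    (hp : 2 ≤ p) : ContinuousWithinAt (fun q => DD a q v) (Ici 2) p := by
  apply intervalIntegral.continuousWithinAt_of_dominated_interval
    (bound := fun r => M * (1 + |v r| ^ (p + 1)))
  · filter_upwards [self_mem_nhdsWithin] with q hq
    exact (DD_cont ha.1 hv hq).aestronglyMeasurable
  · have h1 : ∀ᶠ q in 𝓝[Ici 2] p, q < p + 1 :=
      nhdsWithin_le_nhds (Iio_mem_nhds (by linarith))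
    filter_upwards [self_mem_nhdsWithin, h1] with q hq hq1
    have hq : (2:ℝ) ≤ q := hq
    refine Filter.Eventually.of_forall fun x hx => ?_
    rw [uIoc_of_le zero_le_one] at hx
    have hb : |v x| ^ q ≤ 1 + |v x| ^ (p + 1) := by
      have h0 := Real.rpow_nonneg (abs_nonneg (v x)) (p + 1)
      rcases le_or_gt (|v x|) 1 with h | h
      · have := Real.rpow_le_one (abs_nonneg _) h (by linarith : 0 ≤ q)
        linarith
      · have := Real.rpow_le_rpow_of_exponent_le h.le hq1.le
        linarith
    have hv0 := Real.rpow_nonneg (abs_nonneg (v x)) q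
    have hx0 : 0 ≤ x ^ (q - 2) := Real.rpow_nonneg hx.1.le _
    have hx1 : x ^ (q - 2) ≤ 1 := Real.rpow_le_one hx.1.le hx.2 (by linarith)
    have ha0 := ha.2.1 x
    have ha1 := ha.2.2.1 x
    have hM := ha.2.2.2.1
    rw [Real.norm_of_nonneg (mul_nonneg (mul_nonneg hx0 ha0) hv0)]
    calc x ^ (q - 2) * a x * |v x| ^ q ≤ 1 * M * (1 + |v x| ^ (p + 1)) := by gcongr
      _ = _ := by ring
  · exact (continuous_const.mul (continuous_const.add
      (hv.abs.rpow_const fun _ => Or.inr (by linarith)))).intervalIntegrable _ _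
  · refine Filter.Eventually.of_forall fun x hx => ?_
    rw [uIoc_of_le zero_le_one] at hx
    have h1 : ContinuousAt (fun q : ℝ => x ^ (q - 2)) p :=
      by
      have hsub : ContinuousAt (fun q : ℝ => q - 2) p := by fun_prop
      exact ContinuousAt.rpow continuousAt_const hsub (Or.inl hx.1.ne')
    have h2 : ContinuousAt (fun q : ℝ => |v x| ^ q) p :=
      Real.continuousAt_const_rpow' (by linarith : p ≠ 0)
    exact ((h1.mul continuousAt_const).mul h2).continuousWithinAt

lemma L_usc {M : ℝ} {a : ℝ → ℝ} (ha : AA M a) {p c : ℝ} (hp : 2 ≤ p)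
    (hc : (p - 1) * eta1 a p < c) : ∀ᶠ q in 𝓝[Ici 2] p, (q - 1) * eta1 a q < c := by
  have hc0 : 0 < c := (L_pos ha hp).trans hc
  obtain ⟨w, hw, hN, hD⟩ : ∃ w, WW w ∧ NN p w = 1 ∧ 1 < c * DD a p (VV w) := by
    by_contra! h
    exact absurd (lemB ha hp hc0.le h) (not_le.2 hc)
  have h1 : ContinuousWithinAt (fun q => c * DD a q (VV w) - NN q w) (Ici 2) p :=
    (continuousWithinAt_const.mul (DD_tendsto ha (VV_cont hw.1) hp)).sub (NN_tendsto hw.1 hp)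
  have h2 : ∀ᶠ q in 𝓝[Ici 2] p, 0 < c * DD a q (VV w) - NN q w :=
    h1.eventually_const_lt (by show 0 < c * DD a p (VV w) - NN p w; rw [hN]; linarith)
  filter_upwards [self_mem_nhdsWithin, h2] with q hq hq2
  have h3 := lemA ha hq hw
  have h4 : (q - 1) * eta1 a q * DD a q (VV w) < c * DD a q (VV w) := by linarith
  exact lt_of_mul_lt_mul_right h4 (DD_nonneg ha.2.1 _ _)

lemma L_left {M : ℝ} {a : ℝ → ℝ} (ha : AA M a) {p q : ℝ} (hq : 2 < q) (hqp : q ≤ p) :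
    (((p - 1) * eta1 a p)⁻¹ + M * ((p - q) / (q - 2) + (p - q) / q + p * (1 - q / p)))⁻¹
      ≤ (q - 1) * eta1 a q := by
  have hp : 2 < p := lt_of_lt_of_le hq hqp
  have hL := L_pos ha hp.le
  have hM := ha.2.2.2.1
  have hs : 0 < q / p := by positivity
  have hs1 : q / p ≤ 1 := by rw [div_le_one (by linarith)]; exact hqp
  set L := (p - 1) * eta1 a p
  set ω := (p - q) / (q - 2) + (p - q) / q + p * (1 - q / p) with hω
  have hω0 : 0 ≤ ω := by
    have h1 : 0 ≤ (p - q) / (q - 2) := div_nonneg (by linarith) (by linarith)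
    have h2 : 0 ≤ (p - q) / q := div_nonneg (by linarith) (by linarith)
    have h3 : 0 ≤ p * (1 - q / p) := mul_nonneg (by linarith) (by linarith)
    positivity
  have hpos : 0 < L⁻¹ + M * ω := by positivity
  refine lemB ha hq.le (inv_pos.2 hpos).le fun w hw hN => ?_
  rw [inv_mul_le_iff₀ hpos, mul_one]
  set u : ℝ → ℝ := fun x => w x ^ (q / p) with hu
  have hW : WW u := ⟨hw.1.rpow_const fun _ => Or.inr hs.le, fun r => Real.rpow_nonneg (hw.2.1 r) _,
    by simp only [hu, hw.2.2]; exact Real.zero_rpow hs.ne'⟩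
  have hNu : NN p u = 1 := by
    rw [← hN]
    unfold NN
    congr 1; ext x
    rw [abs_of_nonneg (hW.2.1 x), abs_of_nonneg (hw.2.1 x), ← Real.rpow_mul (hw.2.1 x)]
    congr 1; field_simp
  have hDu : DD a p (VV u) ≤ L⁻¹ := by
    have := lemA ha hp.le hW
    rw [hNu] at this
    rw [← one_div, le_div_iff₀ hL]; linarith
  have hV : ∀ r ∈ Icc (0:ℝ) 1, VV w r - (1 - q / p) ≤ VV u r := by
    intro r hr
    have hiw := hw.1.intervalIntegrable (μ := MeasureTheory.volume) r 1
    have hiu := hW.1.intervalIntegrable (μ := MeasureTheory.volume) r 1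
    have hin := NN_int hw.1 (by linarith : 0 ≤ q) r 1
    have h1 : VV w r - VV u r ≤ (1 - q / p) * ∫ x in r..1, |w x| ^ q := by
      unfold VV
      rw [← intervalIntegral.integral_sub hiw hiu, ← intervalIntegral.integral_const_mul]
      apply intervalIntegral.integral_mono_on hr.2 (hiw.sub hiu) (hin.const_mul _)
      intro x _
      rw [abs_of_nonneg (hw.2.1 x)]
      exact pw4 (hw.2.1 x) hs hs1 hq.le
    have h2 : ∫ x in r..1, |w x| ^ q ≤ 1 := by
      refine le_trans ?_ hN.le
      exact intervalIntegral.integral_mono_interval hr.1 hr.2 le_rfl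
        (Filter.Eventually.of_forall fun x => Real.rpow_nonneg (abs_nonneg _) _)
        (NN_int hw.1 (by linarith : 0 ≤ q) 0 1)
    have h3 : (1 - q / p) * ∫ x in r..1, |w x| ^ q ≤ (1 - q / p) * 1 :=
      mul_le_mul_of_nonneg_left h2 (by linarith)
    linarith
  have hi1 := (DD_cont ha.1 (VV_cont hw.1) hq.le).intervalIntegrable
    (μ := MeasureTheory.volume) 0 1
  have hi2 := (DD_cont ha.1 (VV_cont hW.1) hp.le).intervalIntegrable
    (μ := MeasureTheory.volume) 0 1
  have hfin : DD a q (VV w) - DD a p (VV u) ≤ ∫ r in (0:ℝ)..1, M * ω := by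
    unfold DD
    rw [← intervalIntegral.integral_sub hi1 hi2]
    apply intervalIntegral.integral_mono_on zero_le_one (hi1.sub hi2) (by simp)
    intro r hr
    have hx0 := VV_nonneg hw hr.2
    have hx1 := VV_le_one hw (by linarith) hN.le hr
    have hy0 := VV_nonneg hW hr.2
    have hxy := hV r hr
    rw [abs_of_nonneg hx0, abs_of_nonneg hy0]
    set x := VV w r
    set y := VV u r
    have e1 := pw2 hr.1 hr.2 (by linarith : 0 < q - 2) (by linarith : q - 2 ≤ p - 2)
    rw [show p - 2 - (q - 2) = p - q by ring] at e1
    have e2 := pw2 hx0 hx1 (by linarith : 0 < q) hqp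
    have e3 := pw3 hx0 hx1 hy0 (by linarith : 0 ≤ 1 - q / p) hxy (by linarith : 1 ≤ p)
    have r0 : 0 ≤ r ^ (p - 2) := Real.rpow_nonneg hr.1 _
    have r1 : r ^ (p - 2) ≤ 1 := Real.rpow_le_one hr.1 hr.2 (by linarith)
    have x0 : 0 ≤ x ^ q := Real.rpow_nonneg hx0 _
    have x1 : x ^ q ≤ 1 := Real.rpow_le_one hx0 hx1 (by linarith)
    have g1 : 0 ≤ (p - q) / (q - 2) := div_nonneg (by linarith) (by linarith)
    have g2 : 0 ≤ (p - q) / q := div_nonneg (by linarith) (by linarith)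
    have g3 : 0 ≤ p * (1 - q / p) := mul_nonneg (by linarith) (by linarith)
    have f1 : (r ^ (q - 2) - r ^ (p - 2)) * x ^ q ≤ (p - q) / (q - 2) := by
      calc _ ≤ (p - q) / (q - 2) * x ^ q := mul_le_mul_of_nonneg_right e1 x0
        _ ≤ (p - q) / (q - 2) * 1 := mul_le_mul_of_nonneg_left x1 g1
        _ = _ := mul_one _
    have f2 : r ^ (p - 2) * (x ^ q - y ^ p) ≤ (p - q) / q + p * (1 - q / p) := by
      calc _ ≤ r ^ (p - 2) * ((p - q) / q + p * (1 - q / p)) :=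
            mul_le_mul_of_nonneg_left (by linarith) r0
        _ ≤ 1 * ((p - q) / q + p * (1 - q / p)) :=
            mul_le_mul_of_nonneg_right r1 (by linarith)
        _ = _ := one_mul _
    have f3 : r ^ (q - 2) * x ^ q - r ^ (p - 2) * y ^ p ≤ ω := by
      rw [hω]; linarith
    calc r ^ (q - 2) * a r * x ^ q - r ^ (p - 2) * a r * y ^ p
        = a r * (r ^ (q - 2) * x ^ q - r ^ (p - 2) * y ^ p) := by ring
      _ ≤ a r * ω := mul_le_mul_of_nonneg_left f3 (ha.2.1 r)
      _ ≤ M * ω := mul_le_mul_of_nonneg_right (ha.2.2.1 r) hω0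
  simp at hfin
  linarith

lemma L_lsc {M : ℝ} {a : ℝ → ℝ} (ha : AA M a) {p c : ℝ} (hp : 2 ≤ p)
    (hc : c < (p - 1) * eta1 a p) : ∀ᶠ q in 𝓝[Ici 2] p, c < (q - 1) * eta1 a q := by
  rcases hp.eq_or_lt with rfl | hp2
  · filter_upwards [self_mem_nhdsWithin] with q hq
    exact lt_of_lt_of_le hc (L_mono ha le_rfl hq)
  have hL := L_pos ha hp
  have hcont : ContinuousAt (fun q => (((p - 1) * eta1 a p)⁻¹ +
      M * ((p - q) / (q - 2) + (p - q) / q + p * (1 - q / p)))⁻¹) p := by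
    have h2 : p - 2 ≠ 0 := by linarith
    have h3 : p ≠ 0 := by linarith
    apply ContinuousAt.inv₀
    · fun_prop (disch := assumption)
    · simp only [sub_self, zero_div, div_self h3, mul_zero, add_zero]
      exact (inv_pos.2 hL).ne'
  have hev := hcont.eventually_const_lt (u := c) (by
    have h3 : p ≠ 0 := by linarith
    simpa only [sub_self, zero_div, div_self h3, mul_zero, add_zero, inv_inv] using hc)
  filter_upwards [self_mem_nhdsWithin, nhdsWithin_le_nhds hev,
    nhdsWithin_le_nhds (Ioi_mem_nhds hp2)] with q hq h1 h2
  rcases le_or_gt q p with h | h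
  · exact lt_of_lt_of_le h1 (L_left ha h2 h)
  · exact lt_of_lt_of_le hc (L_mono ha hp h.le)

lemma main_nice {M : ℝ} {a : ℝ → ℝ} (ha : AA M a) : ContinuousOn (mu1 a) (Ici 2) := by
  have hL : ContinuousOn (fun q => (q - 1) * eta1 a q) (Ici 2) := by
    intro p hp
    exact tendsto_order.2 ⟨fun c hc => L_lsc ha hp hc, fun c hc => L_usc ha hp hc⟩
  have hne : ∀ q ∈ Ici (2:ℝ), q - 1 ≠ 0 := fun q hq => by
    have : (2:ℝ) ≤ q := hq
    linarith
  have hE : ContinuousOn (eta1 a) (Ici 2) := by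
    have : ContinuousOn (fun q => ((q - 1) * eta1 a q) / (q - 1)) (Ici 2) :=
      hL.div (by fun_prop) hne
    refine this.congr fun q hq => ?_
    field_simp [hne q hq]
  refine hE.rpow (continuousOn_const.div (by fun_prop) hne) fun q hq => Or.inl ?_
  have := L_pos ha hq
  intro h
  rw [h, mul_zero] at this
  exact lt_irrefl _ this

theorem stmt5 (a : ℝ → ℝ)
    (ha : ContinuousOn a (Icc 0 1)) (ha0 : ∀ r ∈ Icc (0:ℝ) 1, 0 ≤ a r)
    (hanv : ∀ s t : ℝ, 0 ≤ s → s < t → t ≤ 1 → ∃ r ∈ Ioo s t, a r ≠ 0) :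
    ContinuousOn (mu1 a) (Ici 2) := by
  set b : ℝ → ℝ := IccExtend (zero_le_one' ℝ) (fun x : Icc (0:ℝ) 1 => a x) with hb
  have hbm : ∀ x ∈ Icc (0:ℝ) 1, b x = a x := fun x hx => IccExtend_of_mem _ _ hx
  have heq : mu1 a = mu1 b := by
    funext p
    have : eta1 a p = eta1 b p := by
      have hD : ∀ v : ℝ → ℝ, (∫ r in (0:ℝ)..1, r ^ (p - 2) * a r * |v r| ^ p) =
          ∫ r in (0:ℝ)..1, r ^ (p - 2) * b r * |v r| ^ p := by
        intro v
        apply intervalIntegral.integral_congr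
        intro r hr
        rw [uIcc_of_le zero_le_one] at hr
        simp only [hbm r hr]
      unfold eta1
      simp only [hD]
    unfold mu1
    rw [this]
  obtain ⟨C, hC⟩ := isCompact_Icc.exists_bound_of_continuousOn ha
  have hA : AA (|C| + 1) b := by
    refine ⟨Continuous.Icc_extend' (continuousOn_iff_continuous_domRestrict.1 ha), fun r => ?_,
      fun r => ?_, by positivity, fun s t hs hst ht => ?_⟩
    · exact ha0 _ (projIcc 0 1 zero_le_one r).2
    · have h1 := hC _ (projIcc 0 1 zero_le_one r).2
      have h2 : b r = a (projIcc 0 1 zero_le_one r) := rfl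
      rw [h2]
      have := le_abs_self C
      have := Real.le_norm_self (a (projIcc 0 1 zero_le_one r))
      linarith
    · obtain ⟨r, hr, hne⟩ := hanv s t hs hst ht
      refine ⟨r, hr, ?_⟩
      rwa [hbm r ⟨hs.trans hr.1.le, hr.2.le.trans ht⟩]
  rw [heq]
  exact main_nice hA
end
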